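/- Let Q be a finite quiver without oriented cycles, n = (n_x)_{x∈Q0} a dimension vector, and K = (K_x) a family of subsets K_x ⊆ {1,…,n_x} with |K_x| = k_x. Then K is Q-intersecting for n if and only if for every family L = (L_x), L_x ⊆ {1,…,k_x} with |L_x| = l_x, that is Q-intersecting for the dimension vector k = (k_x), one has Σ_{x∈Q0} Σ_{j=1}^{l_x} (K_x(L_x(j)) − j) ≥ Σ_{a:x→y∈Q1} l_x (n_y − l_y). -/

import Mathlib

open Matrix

noncomputable section

/-- The standard flag subspace `span(e_1, …, e_j)` of `ℂ^n` (with 0-indexed coordinates,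
this is the space of vectors vanishing on all coordinates `≥ j`). -/
def stdFlag (n j : ℕ) : Submodule ℂ (Fin n → ℂ) where
  carrier := {f | ∀ i : Fin n, j ≤ (i : ℕ) → f i = 0}
  add_mem' := by
    intro a b ha hb i hi
    simp only [Pi.add_apply, ha i hi, hb i hi, add_zero]
  zero_mem' := by intro i _; rfl
  smul_mem' := by
    intro c f hf i hi
    simp only [Pi.smul_apply, hf i hi, smul_zero]

/-- A quiver given by source and target maps has no oriented cycles. -/
def NoCycles {V A : Type} (src tgt : A → V) : Prop :=
  ∀ (k : ℕ) (f : Fin (k + 1) → A),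
    (∀ i : Fin k, tgt (f i.castSucc) = src (f i.succ)) →
    tgt (f (Fin.last k)) ≠ src (f 0)

/-- `α ≤_Q n` : every representation of the quiver on the spaces `ℂ^{n_x}` has a
subrepresentation of dimension vector `α`. -/
def HasSubrepOfDim {V A : Type} (src tgt : A → V) (n : V → ℕ) (α : V → ℕ) : Prop :=
  ∀ r : ∀ a : A, (Fin (n (src a)) → ℂ) →ₗ[ℂ] (Fin (n (tgt a)) → ℂ),
    ∃ S : ∀ x : V, Submodule ℂ (Fin (n x) → ℂ),
      (∀ x : V, Module.finrank ℂ (S x) = α x) ∧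
      (∀ a : A, (S (src a)).map (r a) ≤ S (tgt a))

/-- A family `K = (K_x)` of subsets `K_x ⊆ {1,…,n_x}` is `Q`-intersecting for `n` if every
representation of the quiver on the `ℂ^{n_x}` admits a subrepresentation `S` lying in the
Schubert variety indexed by `K` (w.r.t. the standard flags). -/
def IsQIntersecting {V A : Type} (src tgt : A → V) (n : V → ℕ)
    (K : ∀ x : V, Finset (Fin (n x))) : Prop :=
  ∀ r : ∀ a : A, (Fin (n (src a)) → ℂ) →ₗ[ℂ] (Fin (n (tgt a)) → ℂ),
    ∃ S : ∀ x : V, Submodule ℂ (Fin (n x) → ℂ),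
      (∀ x : V, Module.finrank ℂ (S x) = (K x).card) ∧
      (∀ x : V, ∀ j : Fin (K x).card,
        (j : ℕ) + 1 ≤ Module.finrank ℂ
          ((S x ⊓ stdFlag (n x) ((((K x).orderIsoOfFin rfl j : Fin (n x)) : ℕ) + 1) :
            Submodule ℂ (Fin (n x) → ℂ)))) ∧
      (∀ a : A, (S (src a)).map (r a) ≤ S (tgt a))

/-- The expected dimension `edim_{Q,B}(K, n)`. -/
def edimQB {V A : Type} [Fintype V] [Fintype A] (src tgt : A → V) (n : V → ℕ)
    (K : ∀ x : V, Finset (Fin (n x))) : ℤ :=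
  (∑ x : V, ∑ j : Fin (K x).card,
      (((((K x).orderIsoOfFin rfl j : Fin (n x)) : ℕ) : ℤ) - ((j : ℕ) : ℤ))) -
  ∑ a : A, ((K (src a)).card : ℤ) * ((n (tgt a) : ℤ) - ((K (tgt a)).card : ℤ))

/-- Composition `K ∘ L` of a family of subsets with a family of subsets of the index sets. -/
def composeFam {V : Type} {n : V → ℕ} (K : ∀ x : V, Finset (Fin (n x)))
    (L : ∀ x : V, Finset (Fin (K x).card)) : ∀ x : V, Finset (Fin (n x)) :=
  fun x => (L x).image (fun j => ((K x).orderIsoOfFin rfl j : Fin (n x)))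

/-- The moment map for the action of `∏_x U(n_x)` on the representation space of the quiver,
`μ_x(r) = Σ_{b : y→x} r_b r_b^* − Σ_{a : x→y} r_a^* r_a`. -/
def momentMap {V A : Type} [Fintype A] [DecidableEq V] (src tgt : A → V) (n : V → ℕ)
    (r : ∀ a : A, Matrix (Fin (n (tgt a))) (Fin (n (src a))) ℂ) (x : V) :
    Matrix (Fin (n x)) (Fin (n x)) ℂ :=
  (∑ a : A, if h : tgt a = x then
      Matrix.reindex (finCongr (congrArg n h)) (finCongr (congrArg n h)) (r a * (r a)ᴴ)
    else 0) -
  (∑ a : A, if h : src a = x then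
      Matrix.reindex (finCongr (congrArg n h)) (finCongr (congrArg n h)) ((r a)ᴴ * r a)
    else 0)

/-! ### The quiver `Q_{3,3}` with vertices `1,…,6` and arrows `1→3, 2→3, 4→3, 4→5, 4→6`
(0-indexed: `0→2, 1→2, 3→2, 3→4, 3→5`). -/

def q33src : Fin 5 → Fin 6 := ![0, 1, 3, 3, 3]

def q33tgt : Fin 5 → Fin 6 := ![2, 2, 2, 4, 5]

/-- The dimension vector `[p,p,p,q,q,q]` for `Q_{3,3}`. -/
def n33 (p q : ℕ) : Fin 6 → ℕ
  | ⟨0, _⟩ => p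
  | ⟨1, _⟩ => p
  | ⟨2, _⟩ => p
  | ⟨3, _⟩ => q
  | ⟨4, _⟩ => q
  | ⟨5, _⟩ => q

/-- A family of subsets for `Q_{3,3}` built from three subsets of `{1,…,p}` (vertices 1,2,3)
and three subsets of `{1,…,q}` (vertices 4,5,6). -/
def fam6 (p q : ℕ) (K : Fin 3 → Finset (Fin p)) (L : Fin 3 → Finset (Fin q)) :
    ∀ x : Fin 6, Finset (Fin (n33 p q x))
  | ⟨0, _⟩ => K 0
  | ⟨1, _⟩ => K 1
  | ⟨2, _⟩ => K 2
  | ⟨3, _⟩ => L 0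
  | ⟨4, _⟩ => L 1
  | ⟨5, _⟩ => L 2

/-! ### The pseudo-unitary group `U(p,q)` -/

/-- The matrix `η = diag(I_p, −I_q)`. -/
def etaMat (p q : ℕ) : Matrix (Fin (p + q)) (Fin (p + q)) ℂ :=
  Matrix.diagonal fun i => if (i : ℕ) < p then 1 else -1

/-- Membership in `U(p,q) = {g : gᴴ η g = η}`. -/
def InUpq (p q : ℕ) (g : Matrix (Fin (p + q)) (Fin (p + q)) ℂ) : Prop :=
  gᴴ * etaMat p q * g = etaMat p q

/-- The central element `Z = diag(q I_p, −p I_q)`. -/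
def Zmat (p q : ℕ) : Matrix (Fin (p + q)) (Fin (p + q)) ℂ :=
  Matrix.diagonal fun i => if (i : ℕ) < p then (q : ℂ) else -(p : ℂ)

/-- The complex diagonal matrix with entries a real sequence. -/
def Dmat {n : ℕ} (A : Fin n → ℝ) : Matrix (Fin n) (Fin n) ℂ :=
  Matrix.diagonal fun i => (A i : ℂ)

/-- The block-diagonal matrix `u ⊕ v`. -/
def blockDiag {p q : ℕ} (u : Matrix (Fin p) (Fin p) ℂ) (v : Matrix (Fin q) (Fin q) ℂ) :
    Matrix (Fin (p + q)) (Fin (p + q)) ℂ :=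
  Matrix.reindex finSumFinEquiv finSumFinEquiv (Matrix.fromBlocks u 0 0 v)

end

open MvPolynomial in
/-- The image of a dominant polynomial map between affine spaces over an algebraically closed
field contains the complement of a hypersurface. -/
theorem exists_ne_zero_forall_eval_ne_zero_mem_range {σ τ : Type} [Finite σ] [Finite τ]
    (F : τ → MvPolynomial σ ℂ) (hF : Function.Injective (aeval (R := ℂ) F)) :
    ∃ g : MvPolynomial τ ℂ, g ≠ 0 ∧
      ∀ r : τ → ℂ, eval r g ≠ 0 → ∃ s : σ → ℂ, ∀ t, eval s (F t) = r t := by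
  set f : MvPolynomial τ ℂ →+* MvPolynomial σ ℂ := (aeval (R := ℂ) F).toRingHom with hf
  have hft : f.FiniteType := by
    have h1 : (f.comp (C : ℂ →+* MvPolynomial τ ℂ)).FiniteType := by
      have : f.comp (C : ℂ →+* MvPolynomial τ ℂ) = algebraMap ℂ (MvPolynomial σ ℂ) := by
        ext x; simp [hf]
      rw [this, RingHom.finiteType_algebraMap]
      infer_instance
    exact RingHom.FiniteType.of_comp_finiteType h1
  have hfp : f.FinitePresentation := RingHom.FinitePresentation.of_finiteType.mp hft
  obtain ⟨S, hS⟩ := PrimeSpectrum.exists_constructibleSetData_iff.mpr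
    (PrimeSpectrum.isConstructible_range_comap hfp)
  have hker : (PrimeSpectrum.comap f ⊥).asIdeal = ⊥ := by
    rw [PrimeSpectrum.comap_asIdeal]
    exact (RingHom.injective_iff_ker_eq_bot f).mp hF
  have hmem : PrimeSpectrum.comap f ⊥ ∈ S.toSet := hS ▸ Set.mem_range_self _
  simp only [PrimeSpectrum.ConstructibleSetData.toSet, Set.mem_iUnion] at hmem
  obtain ⟨D, hD, hbot⟩ := hmem
  have hg : ∀ i, D.g i = 0 := by
    intro i
    have := hbot.1 (Set.mem_range_self i)
    rwa [SetLike.mem_coe, hker] at this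
  have hne : D.f ≠ 0 := by
    intro h
    apply hbot.2
    rw [PrimeSpectrum.mem_zeroLocus, h]
    simp
  refine ⟨D.f, hne, fun r hr => ?_⟩
  let m : PrimeSpectrum (MvPolynomial τ ℂ) := ⟨vanishingIdeal ℂ {r}, inferInstance⟩
  have hmax : (vanishingIdeal ℂ {r} : Ideal (MvPolynomial τ ℂ)).IsMaximal := inferInstance
  have hm : m ∈ Set.range (PrimeSpectrum.comap f) := by
    rw [← hS]
    simp only [PrimeSpectrum.ConstructibleSetData.toSet, Set.mem_iUnion]
    refine ⟨D, hD, ?_, ?_⟩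
    · rintro _ ⟨i, rfl⟩
      rw [hg i]
      exact Ideal.zero_mem _
    · rw [PrimeSpectrum.mem_zeroLocus, Set.singleton_subset_iff, SetLike.mem_coe,
        mem_vanishingIdeal_singleton_iff]
      simpa [aeval_eq_eval] using hr
  obtain ⟨P, hP⟩ := hm
  obtain ⟨M, hM, hPM⟩ := P.asIdeal.exists_le_maximal P.2.ne_top
  have hle : (vanishingIdeal ℂ {r} : Ideal (MvPolynomial τ ℂ)) ≤ M.comap f := by
    have h : (PrimeSpectrum.comap f P).asIdeal = vanishingIdeal ℂ {r} := by rw [hP]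
    rw [← h, PrimeSpectrum.comap_asIdeal]
    exact Ideal.comap_mono hPM
  obtain ⟨s, rfl⟩ := isMaximal_iff_eq_vanishingIdeal_singleton.mp hM
  refine ⟨s, fun t => ?_⟩
  have hx : (X t - C (r t) : MvPolynomial τ ℂ) ∈ vanishingIdeal ℂ {r} := by
    rw [mem_vanishingIdeal_singleton_iff]; simp
  have := hle hx
  rw [Ideal.mem_comap, mem_vanishingIdeal_singleton_iff] at this
  simpa [hf, aeval_eq_eval, sub_eq_zero] using this

open MvPolynomial in
theorem card_le_of_injective_aeval {σ τ : Type} [Fintype σ] [Fintype τ]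
    (F : τ → MvPolynomial σ ℂ) (hF : Function.Injective (aeval (R := ℂ) F)) :
    Fintype.card τ ≤ Fintype.card σ := by
  have h := trdeg_le_of_injective (aeval (R := ℂ) F) hF
  rw [MvPolynomial.trdeg_of_isDomain, MvPolynomial.trdeg_of_isDomain] at h
  simpa using h

/-- Rank is lower semicontinuous along a pencil, in the Zariski topology of the parameter line. -/
theorem finite_setOf_finrank_range_lt {P T : Type*} [AddCommGroup P] [Module ℂ P]
    [AddCommGroup T] [Module ℂ T] [FiniteDimensional ℂ P] [FiniteDimensional ℂ T]
    (A B : P →ₗ[ℂ] T) (t₀ : ℂ) :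
    {t : ℂ | Module.finrank ℂ (LinearMap.range (A + t • B)) <
      Module.finrank ℂ (LinearMap.range (A + t₀ • B))}.Finite := by
  set R := LinearMap.range (A + t₀ • B) with hR
  obtain ⟨s, hs⟩ := (A + t₀ • B).rangeRestrict.exists_rightInverse_of_surjective
    (LinearMap.range_rangeRestrict _)
  obtain ⟨q, hq⟩ := R.subtype.exists_leftInverse_of_injective R.ker_subtype
  let b := Module.finBasis ℂ R
  let M0 := LinearMap.toMatrix b b (q ∘ₗ A ∘ₗ s)
  let M1 := LinearMap.toMatrix b b (q ∘ₗ B ∘ₗ s)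
  let p : Polynomial ℂ := (M0.map Polynomial.C + (Polynomial.X : Polynomial ℂ) •
    M1.map Polynomial.C).det
  have hp : ∀ t, p.eval t = LinearMap.det (q ∘ₗ (A + t • B) ∘ₗ s) := by
    intro t
    rw [← LinearMap.det_toMatrix b, ← Polynomial.coe_evalRingHom, RingHom.map_det]
    congr 1
    ext i j
    simp [M0, M1, LinearMap.comp_add, LinearMap.add_comp,
      LinearMap.smul_comp, LinearMap.comp_smul]
    exact mul_comm _ _
  have h0 : p ≠ 0 := by
    intro h
    have h1 := hp t₀
    have h2 : q ∘ₗ (A + t₀ • B) ∘ₗ s = LinearMap.id := by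
      have : (A + t₀ • B) ∘ₗ s = R.subtype := by
        ext x
        have := congrArg (fun f => ((f x : R) : T)) hs
        simpa using this
      rw [this, hq]
    rw [h2, h, LinearMap.det_id] at h1
    simp at h1
  refine (p.roots.toFinset.finite_toSet).subset fun t ht => ?_
  by_contra hroot
  have hdet : LinearMap.det (q ∘ₗ (A + t • B) ∘ₗ s) ≠ 0 := by
    rw [← hp]
    intro h
    apply hroot
    simp [h0, h]
  have hinj : LinearMap.range (q ∘ₗ (A + t • B) ∘ₗ s) = ⊤ := by
    rw [LinearMap.range_eq_top]
    exact (LinearMap.equivOfDetNeZero _ hdet).surjective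
  have : Module.finrank ℂ R ≤ Module.finrank ℂ (LinearMap.range (A + t • B)) := by
    rw [← finrank_top (R := ℂ) (M := R), ← hinj, LinearMap.range_comp]
    refine (Submodule.finrank_map_le _ _).trans ?_
    exact Submodule.finrank_mono (LinearMap.range_comp_le_range _ _)
  exact absurd ht (not_lt.mpr this)

/-- In a pencil whose rank is maximal at `A`, the direction of the pencil maps the kernel of `A`
into the range of `A`. -/
theorem mem_range_of_finrank_range_le {P T : Type*} [AddCommGroup P] [Module ℂ P]
    [AddCommGroup T] [Module ℂ T] [FiniteDimensional ℂ P] [FiniteDimensional ℂ T]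
    (A B : P →ₗ[ℂ] T)
    (h : ∀ t : ℂ, Module.finrank ℂ (LinearMap.range (A + t • B)) ≤
      Module.finrank ℂ (LinearMap.range A)) (u : P) (hu : A u = 0) :
    B u ∈ LinearMap.range A := by
  by_contra hB
  let A' : (P × ℂ) →ₗ[ℂ] T := A.coprod (LinearMap.toSpanSingleton ℂ T (B u))
  let B' : (P × ℂ) →ₗ[ℂ] T := B.coprod 0
  have hfin := finite_setOf_finrank_range_lt A' B' 0
  obtain ⟨t, ht⟩ := ((hfin.union (Set.finite_singleton (0 : ℂ))).infinite_compl).nonempty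
  simp only [Set.mem_compl_iff, Set.mem_union, Set.mem_ofPred_eq, not_or, not_lt,
    Set.mem_singleton_iff] at ht
  obtain ⟨h1, h2⟩ := ht
  rw [show A' + (0 : ℂ) • B' = A' by simp] at h1
  have h3 : LinearMap.range (A' + t • B') ≤ LinearMap.range (A + t • B) := by
    rintro _ ⟨⟨x, c⟩, rfl⟩
    refine ⟨x + (t⁻¹ * c) • u, ?_⟩
    simp [A', B', hu, smul_smul, h2]
    abel
  have h4 : LinearMap.range A < LinearMap.range A' := by
    refine lt_of_le_of_ne ?_ ?_
    · rintro _ ⟨x, rfl⟩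
      exact ⟨(x, 0), by simp [A']⟩
    · intro he
      apply hB
      rw [he]
      exact ⟨(0, 1), by simp [A']⟩
  have h5 := Submodule.finrank_lt_finrank_of_lt h4
  have h6 := Submodule.finrank_mono h3
  have h7 := h t
  omega

/-- A subset of a vector space that contains all but finitely many points of every line meeting
it. -/
def IsLineOpen {E : Type*} [AddCommGroup E] [Module ℂ E] (G : Set E) : Prop :=
  ∀ x ∈ G, ∀ y, {t : ℂ | y + t • (x - y) ∉ G}.Finite

namespace IsLineOpen

variable {E : Type*} [AddCommGroup E] [Module ℂ E]

theorem inter {G H : Set E} (hG : IsLineOpen G) (hH : IsLineOpen H) : IsLineOpen (G ∩ H) := by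
  intro x hx y
  refine ((hG x hx.1 y).union (hH x hx.2 y)).subset fun t ht => ?_
  simp only [Set.mem_ofPred_eq, Set.mem_inter_iff, not_and_or, Set.mem_union] at ht ⊢
  exact ht

theorem inter_nonempty {G H : Set E} (hG : IsLineOpen G) (hH : IsLineOpen H)
    (hG' : G.Nonempty) (hH' : H.Nonempty) : (G ∩ H).Nonempty := by
  obtain ⟨x, hx⟩ := hG'
  obtain ⟨y, hy⟩ := hH'
  have h1 := hG x hx y
  have h2 : {t : ℂ | y + t • (x - y) ∉ H}.Finite := by
    refine ((hH y hy x).image (fun t => 1 - t)).subset fun t ht => ⟨1 - t, ?_, by simp⟩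
    simp only [Set.mem_ofPred_eq] at ht ⊢
    convert ht using 2
    module
  obtain ⟨t, ht⟩ := ((h1.union h2).infinite_compl).nonempty
  simp only [Set.mem_compl_iff, Set.mem_union, Set.mem_ofPred_eq, not_or, not_not] at ht
  exact ⟨_, ht.1, ht.2⟩

theorem iInter_nonempty {ι : Type*} [Finite ι] {G : ι → Set E} (hG : ∀ i, IsLineOpen (G i))
    (hne : ∀ i, (G i).Nonempty) : (⋂ i, G i).Nonempty := by
  classical
  cases nonempty_fintype ι
  have key : ∀ s : Finset ι, IsLineOpen (⋂ i ∈ s, G i) ∧ (⋂ i ∈ s, G i).Nonempty := by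
    intro s
    induction s using Finset.induction_on with
    | empty => exact ⟨fun x _ y => by simp, ⟨0, by simp⟩⟩
    | insert i s _ ih =>
      rw [Finset.set_biInter_insert]
      exact ⟨(hG i).inter ih.1, (hG i).inter_nonempty ih.1 (hne i) ih.2⟩
  simpa using (key Finset.univ).2

theorem preimage {F : Type*} [AddCommGroup F] [Module ℂ F] {G : Set F} (hG : IsLineOpen G)
    (f : E → F) (hf : ∀ x y (t : ℂ), f (y + t • (x - y)) = f y + t • (f x - f y)) :
    IsLineOpen (f ⁻¹' G) := by
  intro x hx y
  simpa only [Set.mem_preimage, hf] using hG (f x) hx (f y)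

theorem le_finrank_range {P T : Type*} [AddCommGroup P] [Module ℂ P]
    [AddCommGroup T] [Module ℂ T] [FiniteDimensional ℂ P] [FiniteDimensional ℂ T] (ρ : ℕ) :
    IsLineOpen {A : P →ₗ[ℂ] T | ρ ≤ Module.finrank ℂ (LinearMap.range A)} := by
  intro A hA B
  refine (finite_setOf_finrank_range_lt B (A - B) 1).subset fun t ht => ?_
  simp only [Set.mem_ofPred_eq, not_le] at ht hA ⊢
  rw [show B + (1 : ℂ) • (A - B) = A by simp]
  omega

theorem eval_ne_zero {τ : Type} (p : MvPolynomial τ ℂ) :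
    IsLineOpen {r : τ → ℂ | MvPolynomial.eval r p ≠ 0} := by
  intro x hx y
  obtain ⟨q, hq⟩ : ∃ q : Polynomial ℂ,
      ∀ t : ℂ, q.eval t = MvPolynomial.eval (y + t • (x - y)) p := by
    clear hx
    induction p using MvPolynomial.induction_on with
    | C a => exact ⟨Polynomial.C a, by simp⟩
    | add p₁ p₂ h₁ h₂ =>
      obtain ⟨q₁, h₁⟩ := h₁
      obtain ⟨q₂, h₂⟩ := h₂
      exact ⟨q₁ + q₂, by simp [h₁, h₂]⟩
    | mul_X p i h =>
      obtain ⟨q, h⟩ := h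
      exact ⟨q * (Polynomial.C (y i) + Polynomial.X * Polynomial.C (x i - y i)), by simp [h]⟩
  have h0 : q ≠ 0 := by
    intro h
    apply hx
    have := hq 1
    simpa [h, eq_comm] using this
  refine (q.roots.toFinset.finite_toSet).subset fun t ht => ?_
  simp only [Set.mem_ofPred_eq, not_not] at ht
  simp [h0, hq, ht]

end IsLineOpen

section Echelon

variable {n : ℕ}

open Classical in
/-- The set of positions of the last nonzero coordinates of the vectors of a subspace. -/
noncomputable def leadingIndices (N : Submodule ℂ (Fin n → ℂ)) : Finset (Fin n) :=
  {i | ∃ u ∈ N, u i ≠ 0 ∧ ∀ i', i < i' → u i' = 0}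

theorem mem_leadingIndices {N : Submodule ℂ (Fin n → ℂ)} {i : Fin n} :
    i ∈ leadingIndices N ↔ ∃ u ∈ N, u i ≠ 0 ∧ ∀ i', i < i' → u i' = 0 := by
  simp [leadingIndices]

/-- The coordinate subspace spanned by the `e_j`, `j ∈ J`. -/
def coordSubspace (J : Finset (Fin n)) : Submodule ℂ (Fin n → ℂ) where
  carrier := {u | ∀ i, i ∉ J → u i = 0}
  add_mem' := by
    intro a b ha hb i hi
    simp [ha i hi, hb i hi]
  zero_mem' := by intro i _; rfl
  smul_mem' := by
    intro c f hf i hi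
    simp [hf i hi]

theorem mem_coordSubspace {J : Finset (Fin n)} {u : Fin n → ℂ} :
    u ∈ coordSubspace J ↔ ∀ i, i ∉ J → u i = 0 := Iff.rfl

theorem mem_stdFlag {t : ℕ} {u : Fin n → ℂ} :
    u ∈ stdFlag n t ↔ ∀ i : Fin n, t ≤ (i : ℕ) → u i = 0 := Iff.rfl

theorem exists_leading_of_ne_zero {u : Fin n → ℂ} (hu : u ≠ 0) :
    ∃ i, u i ≠ 0 ∧ ∀ i', i < i' → u i' = 0 := by
  classical
  have hne : (Finset.univ.filter fun i => u i ≠ 0).Nonempty := by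
    by_contra h
    apply hu
    ext i
    by_contra hi
    exact h ⟨i, by simpa using hi⟩
  refine ⟨_, (Finset.mem_filter.mp (Finset.max'_mem _ hne)).2, fun i' hi' => ?_⟩
  by_contra h
  exact absurd (Finset.le_max' _ i' (by simpa using h)) (not_le.mpr hi')

/-- Matrices `θ` mapping `span {e_j | j ∈ J}` to `span {e_i | i ∉ J}`, strictly upper triangular,
and vanishing on `e_i` for `i ∉ J`. -/
def IsShear (J : Finset (Fin n)) (θ : Matrix (Fin n) (Fin n) ℂ) : Prop :=
  ∀ i j, θ i j ≠ 0 → i ∉ J ∧ j ∈ J ∧ i < j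

theorem IsShear.mul_self {J : Finset (Fin n)} {θ : Matrix (Fin n) (Fin n) ℂ}
    (h : IsShear J θ) : θ * θ = 0 := by
  ext i j
  rw [Matrix.mul_apply]
  refine Finset.sum_eq_zero fun k _ => ?_
  by_contra hk
  exact (h k j (right_ne_zero_of_mul hk)).1 (h i k (left_ne_zero_of_mul hk)).2.1

theorem IsShear.sub_mul_add {J : Finset (Fin n)} {θ : Matrix (Fin n) (Fin n) ℂ}
    (h : IsShear J θ) : (1 - θ) * (1 + θ) = 1 := by
  rw [sub_mul, mul_add, mul_add, h.mul_self]
  simp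

theorem IsShear.add_mul_sub {J : Finset (Fin n)} {θ : Matrix (Fin n) (Fin n) ℂ}
    (h : IsShear J θ) : (1 + θ) * (1 - θ) = 1 := by
  rw [add_mul, mul_sub, mul_sub, h.mul_self]
  simp

/-- A unipotent upper triangular matrix does not change leading coordinates. -/
theorem leading_sub_mulVec {θ : Matrix (Fin n) (Fin n) ℂ} (h : ∀ i j, θ i j ≠ 0 → i < j)
    {u : Fin n → ℂ} {i : Fin n} (hu : ∀ i', i < i' → u i' = 0) (i' : Fin n) (hi' : i ≤ i') :
    ((1 - θ) *ᵥ u) i' = u i' := by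
  rw [Matrix.sub_mulVec, Matrix.one_mulVec, Pi.sub_apply, sub_eq_self, Matrix.mulVec, dotProduct]
  refine Finset.sum_eq_zero fun j _ => ?_
  by_contra hj
  exact right_ne_zero_of_mul hj (hu j (hi'.trans_lt (h i' j (left_ne_zero_of_mul hj))))

theorem leadingIndices_comap {J : Finset (Fin n)} {θ : Matrix (Fin n) (Fin n) ℂ}
    (h : IsShear J θ) (N : Submodule ℂ (Fin n → ℂ)) :
    leadingIndices (N.comap (Matrix.mulVecLin (1 - θ))) = leadingIndices N := by
  ext i
  simp only [mem_leadingIndices, Submodule.mem_comap, Matrix.mulVecLin_apply]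
  constructor
  · rintro ⟨u, hu, hi, hz⟩
    have hl := leading_sub_mulVec (fun i j hij => (h i j hij).2.2) hz
    exact ⟨_, hu, by rwa [hl i le_rfl], fun i' hi' => by rw [hl i' hi'.le, hz i' hi']⟩
  · rintro ⟨u, hu, hi, hz⟩
    have hl := leading_sub_mulVec (θ := -θ) (fun i j hij => (h i j (by simpa using hij)).2.2) hz
    rw [sub_neg_eq_add] at hl
    refine ⟨(1 + θ) *ᵥ u, ?_, by rwa [hl i le_rfl], fun i' hi' => by rw [hl i' hi'.le, hz i' hi']⟩
    rwa [Matrix.mulVec_mulVec, h.sub_mul_add, Matrix.one_mulVec]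

theorem leadingIndices_coordSubspace (J : Finset (Fin n)) :
    leadingIndices (coordSubspace J) = J := by
  ext i
  rw [mem_leadingIndices]
  constructor
  · rintro ⟨u, hu, hi, -⟩
    by_contra h
    exact hi (hu i h)
  · intro hi
    refine ⟨Pi.single i 1, fun i' hi' => ?_, by simp, fun i' hi' => ?_⟩
    · exact Pi.single_eq_of_ne (fun h => hi' (by rw [h]; exact hi)) _
    · exact Pi.single_eq_of_ne hi'.ne' _

theorem leadingIndices_subset_of_le_coordSubspace {J : Finset (Fin n)}
    {N : Submodule ℂ (Fin n → ℂ)} (h : N ≤ coordSubspace J) : leadingIndices N ⊆ J := by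
  intro i hi
  obtain ⟨u, hu, hne, -⟩ := mem_leadingIndices.mp hi
  by_contra hJ
  exact hne (h hu i hJ)

theorem leadingIndices_inf_stdFlag (N : Submodule ℂ (Fin n → ℂ)) (t : ℕ) :
    leadingIndices (N ⊓ stdFlag n t) = (leadingIndices N).filter fun i : Fin n => (i : ℕ) < t := by
  ext i
  simp only [mem_leadingIndices, Finset.mem_filter, Submodule.mem_inf, mem_stdFlag]
  constructor
  · rintro ⟨u, ⟨hu, ht⟩, hi, hz⟩
    refine ⟨⟨u, hu, hi, hz⟩, ?_⟩
    by_contra h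
    exact hi (ht i (not_lt.mp h))
  · rintro ⟨⟨u, hu, hi, hz⟩, ht⟩
    refine ⟨u, ⟨hu, fun i' hi' => hz i' ?_⟩, hi, hz⟩
    rw [Fin.lt_def]; omega

/-- The reduced echelon form of a subspace. -/
theorem exists_isShear (N : Submodule ℂ (Fin n → ℂ)) :
    ∃ θ, IsShear (leadingIndices N) θ ∧ (coordSubspace (leadingIndices N)).comap
      (Matrix.mulVecLin (1 - θ)) = N := by
  classical
  set J := leadingIndices N with hJ
  have key : ∀ m : ℕ, ∀ j : Fin n, (j : ℕ) = m → j ∈ J →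
      ∃ u ∈ N, u j = 1 ∧ (∀ i, j < i → u i = 0) ∧ ∀ i ∈ J, i ≠ j → u i = 0 := by
    intro m
    induction m using Nat.strong_induction_on with
    | _ m ih =>
      intro j hjm hj
      obtain ⟨u, hu, hne, hz⟩ := mem_leadingIndices.mp hj
      have ih' : ∀ i : Fin n, ∃ w ∈ N, (i < j ∧ i ∈ J → w i = 1 ∧ (∀ k, i < k → w k = 0) ∧
          ∀ k ∈ J, k ≠ i → w k = 0) := by
        intro i
        by_cases h : i < j ∧ i ∈ J
        · obtain ⟨w, hw, h'⟩ := ih i (by rw [← hjm]; exact h.1) i rfl h.2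
          exact ⟨w, hw, fun _ => h'⟩
        · exact ⟨0, N.zero_mem, fun h' => absurd h' h⟩
      choose w hwN hw using ih'
      let s : Finset (Fin n) := J.filter fun i => i < j
      have hs : ∀ i ∈ s, i < j ∧ i ∈ J := fun i hi => by simpa [s, and_comm] using hi
      refine ⟨(u j)⁻¹ • (u - ∑ i ∈ s, u i • w i), N.smul_mem _ (N.sub_mem hu
        (N.sum_mem fun i _ => N.smul_mem _ (hwN i))), ?_, ?_, ?_⟩
      · have : ∑ i ∈ s, u i * w i j = 0 := Finset.sum_eq_zero fun i hi => by
          rw [(hw i (hs i hi)).2.1 j (hs i hi).1, mul_zero]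
        simp [Finset.sum_apply, this, hne]
      · intro k hk
        have : ∑ i ∈ s, u i * w i k = 0 := Finset.sum_eq_zero fun i hi => by
          rw [(hw i (hs i hi)).2.1 k ((hs i hi).1.trans hk), mul_zero]
        simp [Finset.sum_apply, this, hz k hk]
      · intro k hkJ hkj
        rcases lt_or_gt_of_ne hkj with hlt | hgt
        · have : ∑ i ∈ s, u i * w i k = u k := by
            rw [Finset.sum_eq_single k]
            · rw [(hw k ⟨hlt, hkJ⟩).1, mul_one]
            · intro i hi hik
              rw [(hw i (hs i hi)).2.2 k hkJ hik.symm, mul_zero]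
            · intro h
              exact absurd (by simp [s, hlt, hkJ]) h
          simp [Finset.sum_apply, this]
        · have : ∑ i ∈ s, u i * w i k = 0 := Finset.sum_eq_zero fun i hi => by
            rw [(hw i (hs i hi)).2.1 k ((hs i hi).1.trans hgt), mul_zero]
          simp [Finset.sum_apply, this, hz k hgt]
  have key' : ∀ j : Fin n, ∃ u ∈ N, j ∈ J → u j = 1 ∧ (∀ i, j < i → u i = 0) ∧
      ∀ i ∈ J, i ≠ j → u i = 0 := by
    intro j
    by_cases h : j ∈ J
    · obtain ⟨u, hu, h'⟩ := key _ j rfl h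
      exact ⟨u, hu, fun _ => h'⟩
    · exact ⟨0, N.zero_mem, fun h' => absurd h' h⟩
  choose w hwN hw using key'
  let θ : Matrix (Fin n) (Fin n) ℂ := fun i j => if i ∉ J ∧ j ∈ J then w j i else 0
  have hθ : ∀ i, i ∉ J → ∀ u : Fin n → ℂ, (θ *ᵥ u) i = ∑ j ∈ J, u j * w j i := by
    intro i hi u
    simp [Matrix.mulVec, dotProduct, θ, hi, mul_comm]
  refine ⟨θ, ?_, ?_⟩
  · intro i j hij
    by_cases h : i ∉ J ∧ j ∈ J
    · refine ⟨h.1, h.2, ?_⟩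
      simp only [θ, if_pos h] at hij
      rcases lt_trichotomy i j with hlt | rfl | hgt
      · exact hlt
      · exact absurd h.2 h.1
      · exact absurd ((hw j h.2).2.1 i hgt) hij
    · simp [θ, h] at hij
  · ext u
    rw [Submodule.mem_comap, Matrix.mulVecLin_apply, mem_coordSubspace]
    have hsub : ∀ i, (u - ∑ j ∈ J, u j • w j) i = if i ∈ J then 0 else ((1 - θ) *ᵥ u) i := by
      intro i
      split_ifs with hi
      · have : ∑ j ∈ J, u j * w j i = u i := by
          rw [Finset.sum_eq_single i]
          · rw [(hw i hi).1, mul_one]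
          · intro j hj hji
            rw [(hw j hj).2.2 i hi hji.symm, mul_zero]
          · exact fun h => absurd hi h
        simp [Finset.sum_apply, this]
      · simp [Matrix.sub_mulVec, hθ i hi, Finset.sum_apply]
    have hmem : ∑ j ∈ J, u j • w j ∈ N := N.sum_mem fun j _ => N.smul_mem _ (hwN j)
    constructor
    · intro h
      have : u - ∑ j ∈ J, u j • w j = 0 := by
        ext i
        rw [hsub]
        split_ifs with hi
        · rfl
        · exact h i hi
      rw [sub_eq_zero.mp this]
      exact hmem
    · intro hu i hi
      have h0 : u - ∑ j ∈ J, u j • w j = 0 := by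
        by_contra hne
        obtain ⟨k, hk, hz⟩ := exists_leading_of_ne_zero hne
        have : k ∈ J := mem_leadingIndices.mpr ⟨_, N.sub_mem hu hmem, hk, hz⟩
        rw [hsub, if_pos this] at hk
        exact hk rfl
      have := hsub i
      rw [h0, if_neg hi] at this
      exact this.symm

theorem finrank_coordSubspace (J : Finset (Fin n)) :
    Module.finrank ℂ (coordSubspace J) = J.card := by
  classical
  let e : coordSubspace J ≃ₗ[ℂ] (J → ℂ) :=
    { toFun := fun u j => u.1 j
      map_add' := fun _ _ => rfl
      map_smul' := fun _ _ => rfl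
      invFun := fun f => ⟨fun i => if h : i ∈ J then f ⟨i, h⟩ else 0, fun i hi => by simp [hi]⟩
      left_inv := by
        intro u
        ext i
        by_cases h : i ∈ J
        · simp [h]
        · simp [h, u.2 i h]
      right_inv := by
        intro f
        ext j
        simp }
  rw [e.finrank_eq]
  simp

theorem finrank_eq_card_leadingIndices (N : Submodule ℂ (Fin n → ℂ)) :
    Module.finrank ℂ N = (leadingIndices N).card := by
  obtain ⟨θ, hθ, h⟩ := exists_isShear N
  rw [← finrank_coordSubspace]
  conv_lhs => rw [← h]
  let e : (Fin n → ℂ) ≃ₗ[ℂ] (Fin n → ℂ) := LinearEquiv.ofLinearMap (Matrix.mulVecLin (1 - θ))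
    (Matrix.mulVecLin (1 + θ))
    (by rw [← Matrix.mulVecLin_mul, hθ.sub_mul_add, Matrix.mulVecLin_one])
    (by rw [← Matrix.mulVecLin_mul, hθ.add_mul_sub, Matrix.mulVecLin_one])
  have he : Matrix.mulVecLin (1 - θ) = (e : (Fin n → ℂ) →ₗ[ℂ] (Fin n → ℂ)) := rfl
  rw [he, Submodule.comap_equiv_eq_map_symm]
  exact LinearEquiv.finrank_map_eq e.symm _

theorem finrank_inf_stdFlag (N : Submodule ℂ (Fin n → ℂ)) (t : ℕ) :
    Module.finrank ℂ (N ⊓ stdFlag n t : Submodule ℂ (Fin n → ℂ)) =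
      ((leadingIndices N).filter fun i : Fin n => (i : ℕ) < t).card := by
  rw [finrank_eq_card_leadingIndices, leadingIndices_inf_stdFlag]

end Echelon

section Representations

variable {V A : Type} (src tgt : A → V) (n : V → ℕ)

/-- Representations of a quiver on the spaces `ℂ^{n_x}`, as families of matrices. -/
abbrev QRep : Type := ∀ a : A, Matrix (Fin (n (tgt a))) (Fin (n (src a))) ℂ

/-- The coordinates of the representation space. -/
abbrev QCoord : Type := Σ a : A, Fin (n (tgt a)) × Fin (n (src a))

variable {src tgt n}

namespace QRep

/-- The vector of matrix entries of a representation. -/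
def coord (r : QRep src tgt n) : QCoord src tgt n → ℂ := fun c => r c.1 c.2.1 c.2.2

/-- The representation with given matrix entries. -/
def ofCoord (f : QCoord src tgt n → ℂ) : QRep src tgt n := fun a i j => f ⟨a, i, j⟩

@[simp] theorem coord_ofCoord (f : QCoord src tgt n → ℂ) : (ofCoord f).coord = f := rfl

/-- A family of subspaces is a subrepresentation. -/
def Stable (r : QRep src tgt n) (N : ∀ x, Submodule ℂ (Fin (n x) → ℂ)) : Prop :=
  ∀ a, ∀ u ∈ N (src a), r a *ᵥ u ∈ N (tgt a)

/-- The representation has a subrepresentation in the Schubert cell of position `J`. -/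
def HasPos (r : QRep src tgt n) (J : ∀ x, Finset (Fin (n x))) : Prop :=
  ∃ N, r.Stable N ∧ ∀ x, leadingIndices (N x) = J x

variable (src tgt) in
/-- The representations that stabilise the coordinate subspaces of `J`. -/
def blockTri (J : ∀ x, Finset (Fin (n x))) : Submodule ℂ (QRep src tgt n) where
  carrier := {v | ∀ a i j, i ∉ J (tgt a) → j ∈ J (src a) → v a i j = 0}
  add_mem' := by
    intro u v hu hv a i j hi hj
    simp [hu a i j hi hj, hv a i j hi hj]
  zero_mem' := by intro a i j _ _; rfl
  smul_mem' := by
    intro c v hv a i j hi hj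
    simp [hv a i j hi hj]

theorem mem_blockTri {J : ∀ x, Finset (Fin (n x))} {v : QRep src tgt n} :
    v ∈ blockTri src tgt J ↔ ∀ a i j, i ∉ J (tgt a) → j ∈ J (src a) → v a i j = 0 := Iff.rfl

/-- The action of `1 + θ`, for a square-zero `θ`. -/
def conj (θ : ∀ x, Matrix (Fin (n x)) (Fin (n x)) ℂ) : QRep src tgt n →ₗ[ℂ] QRep src tgt n where
  toFun v a := (1 + θ (tgt a)) * v a * (1 - θ (src a))
  map_add' u v := by
    ext1 a
    simp only [Pi.add_apply, Matrix.mul_add, Matrix.add_mul]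
  map_smul' c v := by
    ext1 a
    simp only [Pi.smul_apply, Matrix.mul_smul, Matrix.smul_mul, RingHom.id_apply]

theorem conj_apply (θ : ∀ x, Matrix (Fin (n x)) (Fin (n x)) ℂ) (v : QRep src tgt n) (a : A) :
    conj θ v a = (1 + θ (tgt a)) * v a * (1 - θ (src a)) := rfl

theorem conj_conj_neg {J : ∀ x, Finset (Fin (n x))} {θ : ∀ x, Matrix (Fin (n x)) (Fin (n x)) ℂ}
    (hθ : ∀ x, IsShear (J x) (θ x)) (v : QRep src tgt n) : conj θ (conj (-θ) v) = v := by
  ext1 a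
  simp only [conj_apply, Pi.neg_apply, sub_neg_eq_add, ← sub_eq_add_neg]
  calc _ = ((1 + θ (tgt a)) * (1 - θ (tgt a))) * v a *
        ((1 + θ (src a)) * (1 - θ (src a))) := by simp only [Matrix.mul_assoc]
    _ = v a := by rw [(hθ _).add_mul_sub, (hθ _).add_mul_sub, Matrix.one_mul, Matrix.mul_one]

theorem Stable.conj {J : ∀ x, Finset (Fin (n x))} {θ : ∀ x, Matrix (Fin (n x)) (Fin (n x)) ℂ}
    (hθ : ∀ x, IsShear (J x) (θ x)) {v : QRep src tgt n} {N : ∀ x, Submodule ℂ (Fin (n x) → ℂ)}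
    (h : v.Stable N) :
    (QRep.conj θ v).Stable fun x => (N x).comap (Matrix.mulVecLin (1 - θ x)) := by
  intro a u hu
  rw [Submodule.mem_comap, Matrix.mulVecLin_apply] at hu ⊢
  rw [Matrix.mulVec_mulVec, conj_apply, ← Matrix.mul_assoc, ← Matrix.mul_assoc,
    (hθ _).sub_mul_add, Matrix.one_mul, ← Matrix.mulVec_mulVec]
  exact h a _ hu

theorem stable_coordSubspace_iff {J : ∀ x, Finset (Fin (n x))} {v : QRep src tgt n} :
    v.Stable (fun x => coordSubspace (J x)) ↔ v ∈ blockTri src tgt J := by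
  rw [mem_blockTri]
  constructor
  · intro h a i j hi hj
    have := h a (Pi.single j 1) (fun k hk => Pi.single_eq_of_ne (fun h' => hk (by rwa [h'])) _) i hi
    simpa using this
  · intro h a u hu i hi
    rw [Matrix.mulVec, dotProduct]
    refine Finset.sum_eq_zero fun j _ => ?_
    by_cases hj : j ∈ J (src a)
    · rw [h a i j hi hj, zero_mul]
    · rw [hu j hj, mul_zero]

theorem HasPos.conj {J M : ∀ x, Finset (Fin (n x))}
    {θ : ∀ x, Matrix (Fin (n x)) (Fin (n x)) ℂ} (hθ : ∀ x, IsShear (J x) (θ x))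
    {v : QRep src tgt n} (h : v.HasPos M) : (QRep.conj θ v).HasPos M := by
  obtain ⟨N, hN, hM⟩ := h
  exact ⟨_, hN.conj hθ, fun x => by rw [leadingIndices_comap (hθ x), hM]⟩

theorem hasPos_of_mem_blockTri {J : ∀ x, Finset (Fin (n x))} {v : QRep src tgt n}
    (hv : v ∈ blockTri src tgt J) : v.HasPos J :=
  ⟨_, stable_coordSubspace_iff.mpr hv, fun _ => leadingIndices_coordSubspace _⟩

theorem _root_.IsShear.neg {m : ℕ} {J : Finset (Fin m)} {θ : Matrix (Fin m) (Fin m) ℂ}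
    (h : IsShear J θ) : IsShear J (-θ) := fun i j hij => h i j (by simpa using hij)

/-- Reduced echelon forms: a subrepresentation becomes a coordinate subrepresentation after
conjugation by a shear. -/
theorem Stable.exists_shear {r : QRep src tgt n} {N : ∀ x, Submodule ℂ (Fin (n x) → ℂ)}
    (h : r.Stable N) {J : ∀ x, Finset (Fin (n x))} (hJ : ∀ x, leadingIndices (N x) = J x) :
    ∃ θ, (∀ x, IsShear (J x) (θ x)) ∧
      (∀ x, (coordSubspace (J x)).comap (Matrix.mulVecLin (1 - θ x)) = N x) ∧
      QRep.conj (-θ) r ∈ blockTri src tgt J := by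
  have hex : ∀ x, ∃ θ, IsShear (J x) θ ∧
      (coordSubspace (J x)).comap (Matrix.mulVecLin (1 - θ)) = N x := by
    intro x
    rw [← hJ x]
    exact exists_isShear (N x)
  choose θ hθ hN using hex
  refine ⟨θ, hθ, hN, ?_⟩
  rw [← stable_coordSubspace_iff]
  have h2 := h.conj (θ := -θ) (fun x => (hθ x).neg)
  convert h2 using 2 with x
  ext u
  rw [← hN x, Submodule.mem_comap, Submodule.mem_comap, mulVecLin_apply, mulVecLin_apply,
    mulVec_mulVec, Pi.neg_apply, sub_neg_eq_add, (hθ x).sub_mul_add, one_mulVec]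

theorem hasPos_iff {r : QRep src tgt n} {J : ∀ x, Finset (Fin (n x))} :
    r.HasPos J ↔ ∃ θ, (∀ x, IsShear (J x) (θ x)) ∧ ∃ v ∈ blockTri src tgt J,
      QRep.conj θ v = r := by
  constructor
  · rintro ⟨N, hN, hJ⟩
    obtain ⟨θ, hθ, -, hv⟩ := hN.exists_shear hJ
    exact ⟨θ, hθ, _, hv, conj_conj_neg hθ r⟩
  · rintro ⟨θ, hθ, v, hv, rfl⟩
    exact (hasPos_of_mem_blockTri hv).conj hθ

variable (src tgt) in
/-- The representations with a subrepresentation of position `J` are Zariski dense. -/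
def IsDominant (J : ∀ x, Finset (Fin (n x))) : Prop :=
  ∀ p : MvPolynomial (QCoord src tgt n) ℂ,
    (∀ r : QRep src tgt n, r.HasPos J → MvPolynomial.eval r.coord p = 0) → p = 0

theorem exists_forall_hasPos_isDominant [Finite V] :
    ∃ g : MvPolynomial (QCoord src tgt n) ℂ, g ≠ 0 ∧
      ∀ r : QRep src tgt n, MvPolynomial.eval r.coord g ≠ 0 →
        ∀ J, r.HasPos J → IsDominant src tgt J := by
  classical
  have key : ∀ J : ∀ x, Finset (Fin (n x)), ∃ g : MvPolynomial (QCoord src tgt n) ℂ, g ≠ 0 ∧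
      (¬ IsDominant src tgt J → ∀ r : QRep src tgt n, r.HasPos J →
        MvPolynomial.eval r.coord g = 0) := by
    intro J
    by_cases h : IsDominant src tgt J
    · exact ⟨1, one_ne_zero, fun h' => absurd h h'⟩
    · rw [IsDominant] at h
      push Not at h
      obtain ⟨p, hp, hp0⟩ := h
      exact ⟨p, hp0, fun _ => hp⟩
  choose g hg0 hg using key
  cases nonempty_fintype (∀ x, Finset (Fin (n x)))
  refine ⟨∏ J, g J, Finset.prod_ne_zero_iff.mpr fun J _ => hg0 J, fun r hr J hJ => ?_⟩
  rw [map_prod] at hr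
  by_contra h
  exact Finset.prod_ne_zero_iff.mp hr J (Finset.mem_univ _) (hg J h r hJ)

theorem isDominant_univ : IsDominant src tgt fun x => (Finset.univ : Finset (Fin (n x))) := by
  intro p hp
  refine MvPolynomial.funext fun f => ?_
  rw [map_zero, ← coord_ofCoord f]
  exact hp _ (hasPos_of_mem_blockTri fun a i j hi => absurd (Finset.mem_univ i) hi)

end QRep

/-- The entries that a shear is allowed to have. -/
def shearPairs {m : ℕ} (J : Finset (Fin m)) : Finset (Fin m × Fin m) :=
  Finset.univ.filter fun p => p.1 ∉ J ∧ p.2 ∈ J ∧ p.1 < p.2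

@[simp] theorem mem_shearPairs {m : ℕ} {J : Finset (Fin m)} {p : Fin m × Fin m} :
    p ∈ shearPairs J ↔ p.1 ∉ J ∧ p.2 ∈ J ∧ p.1 < p.2 := by simp [shearPairs]

end Representations

section Parametrization

variable {V A : Type} {src tgt : A → V} {n : V → ℕ}

namespace QRep

open MvPolynomial

variable (src tgt) in
/-- The parameters of the representations having a subrepresentation of position `J`. -/
abbrev PosParam (J : ∀ x, Finset (Fin (n x))) : Type :=
  (Σ x, shearPairs (J x)) ⊕
    {c : QCoord src tgt n // ¬ (c.2.1 ∉ J (tgt c.1) ∧ c.2.2 ∈ J (src c.1))}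

open Classical in
/-- The shear with given coefficients. -/
noncomputable def paramShear {R : Type} [Zero R] {J : ∀ x, Finset (Fin (n x))}
    (s : PosParam src tgt J → R) (x : V) : Matrix (Fin (n x)) (Fin (n x)) R :=
  fun i j => if h : (i, j) ∈ shearPairs (J x) then s (Sum.inl ⟨x, (i, j), h⟩) else 0

open Classical in
/-- The block triangular representation with given coefficients. -/
noncomputable def paramBlock {R : Type} [Zero R] {J : ∀ x, Finset (Fin (n x))}
    (s : PosParam src tgt J → R) (a : A) : Matrix (Fin (n (tgt a))) (Fin (n (src a))) R :=
  fun i j => if h : ¬ (i ∉ J (tgt a) ∧ j ∈ J (src a)) then s (Sum.inr ⟨⟨a, i, j⟩, h⟩) else 0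

/-- The generic representation with a subrepresentation of position `J`. -/
noncomputable def genericPos (J : ∀ x, Finset (Fin (n x))) (c : QCoord src tgt n) :
    MvPolynomial (PosParam src tgt J) ℂ :=
  let Y : PosParam src tgt J → MvPolynomial (PosParam src tgt J) ℂ := X
  ((1 + paramShear Y (tgt c.1)) * paramBlock Y c.1 * (1 - paramShear Y (src c.1)) :
    Matrix (Fin (n (tgt c.1))) (Fin (n (src c.1))) _) c.2.1 c.2.2

theorem isShear_paramShear {J : ∀ x, Finset (Fin (n x))} (s : PosParam src tgt J → ℂ) (x : V) :
    IsShear (J x) (paramShear s x) := by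
  intro i j hij
  by_contra h
  exact hij (by rw [paramShear, dif_neg (by simpa using h)])

theorem paramBlock_mem {J : ∀ x, Finset (Fin (n x))} (s : PosParam src tgt J → ℂ) :
    (paramBlock s : QRep src tgt n) ∈ blockTri src tgt J := by
  intro a i j hi hj
  rw [paramBlock, dif_neg (not_not_intro ⟨hi, hj⟩)]

theorem exists_param {J : ∀ x, Finset (Fin (n x))}
    {θ : ∀ x, Matrix (Fin (n x)) (Fin (n x)) ℂ} (hθ : ∀ x, IsShear (J x) (θ x))
    {v : QRep src tgt n} (hv : v ∈ blockTri src tgt J) :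
    ∃ s : PosParam src tgt J → ℂ, paramShear s = θ ∧ paramBlock s = v := by
  refine ⟨Sum.elim (fun c => θ c.1 c.2.1.1 c.2.1.2) fun c => v c.1.1 c.1.2.1 c.1.2.2, ?_, ?_⟩
  · ext x i j
    rw [paramShear]
    split_ifs with h
    · rfl
    · by_contra h0
      exact h (mem_shearPairs.mpr (hθ x i j (Ne.symm h0)))
  · ext a i j
    rw [paramBlock]
    split_ifs with h
    · exact (hv a i j h.1 h.2).symm
    · rfl

theorem eval_genericPos {J : ∀ x, Finset (Fin (n x))} (s : PosParam src tgt J → ℂ)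
    (c : QCoord src tgt n) :
    eval s (genericPos J c) = (conj (paramShear s) (paramBlock s)).coord c := by
  have h1 : ∀ x, (paramShear (X : PosParam src tgt J → MvPolynomial _ ℂ) x).map (eval s) =
      paramShear s x := by
    intro x
    ext i j
    rw [Matrix.map_apply, paramShear, paramShear]
    split_ifs <;> simp
  have h2 : ∀ a, (paramBlock (X : PosParam src tgt J → MvPolynomial _ ℂ) a).map (eval s) =
      paramBlock s a := by
    intro a
    ext i j
    rw [Matrix.map_apply, paramBlock, paramBlock]
    split_ifs <;> simp
  rw [genericPos, coord, conj_apply, ← h1, ← h1, ← h2]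
  have h3 : ∀ {l m : ℕ} (M : Matrix (Fin l) (Fin m) (MvPolynomial (PosParam src tgt J) ℂ)) i j,
      eval s (M i j) = M.map (eval s) i j := fun _ _ _ => rfl
  rw [h3, Matrix.map_mul, Matrix.map_mul, Matrix.map_add _ (map_add _),
    Matrix.map_sub _ (map_sub _), Matrix.map_one _ (map_zero _) (map_one _),
    Matrix.map_one _ (map_zero _) (map_one _)]

theorem IsDominant.injective {J : ∀ x, Finset (Fin (n x))} (h : IsDominant src tgt J) :
    Function.Injective (aeval (R := ℂ) (genericPos (src := src) (tgt := tgt) J)) := by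
  rw [injective_iff_map_eq_zero]
  intro p hp
  refine h p fun r hr => ?_
  obtain ⟨θ, hθ, v, hv, rfl⟩ := hasPos_iff.mp hr
  obtain ⟨s, rfl, rfl⟩ := exists_param hθ hv
  have h1 := congrArg (eval s) hp
  rw [map_zero, aeval_def, ← coe_eval₂Hom] at h1
  have h2 : (eval s).comp (eval₂Hom (algebraMap ℂ _) (genericPos (src := src) (tgt := tgt) J)) =
      eval (conj (paramShear s) (paramBlock s)).coord := by
    ext c
    · simp
    · simp [eval_genericPos]
  rw [← h2]
  exact h1

/-- For a dominant position, the generic representation has a subrepresentation of that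
position. -/
theorem IsDominant.exists_forall_hasPos [Finite V] [Finite A] {J : ∀ x, Finset (Fin (n x))}
    (h : IsDominant src tgt J) : ∃ g : MvPolynomial (QCoord src tgt n) ℂ, g ≠ 0 ∧
      ∀ r : QRep src tgt n, eval r.coord g ≠ 0 → r.HasPos J := by
  obtain ⟨g, hg0, hg⟩ := exists_ne_zero_forall_eval_ne_zero_mem_range _ h.injective
  refine ⟨g, hg0, fun r hr => ?_⟩
  obtain ⟨s, hs⟩ := hg _ hr
  rw [hasPos_iff]
  refine ⟨_, isShear_paramShear s, _, paramBlock_mem s, ?_⟩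
  ext a i j
  rw [← show _ = r a i j from hs ⟨a, i, j⟩, eval_genericPos]
  rfl

theorem IsDominant.sum_le [Fintype V] [Fintype A] {J : ∀ x, Finset (Fin (n x))}
    (h : IsDominant src tgt J) :
    ∑ a, ((J (src a)).card : ℤ) * ((n (tgt a) : ℤ) - ((J (tgt a)).card : ℤ)) ≤
      ∑ x, ((shearPairs (J x)).card : ℤ) := by
  classical
  have h1 := card_le_of_injective_aeval _ h.injective
  rw [Fintype.card_sum, Fintype.card_subtype_compl, Fintype.card_sigma] at h1
  have h2 : Fintype.card {c : QCoord src tgt n // c.2.1 ∉ J (tgt c.1) ∧ c.2.2 ∈ J (src c.1)} =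
      ∑ a, ((J (tgt a))ᶜ ×ˢ (J (src a))).card := by
    rw [Fintype.card_subtype, ← Finset.card_sigma]
    congr 1
    ext ⟨a, i, j⟩
    simp
  have h3 := Fintype.card_subtype_le
    (fun c : QCoord src tgt n => c.2.1 ∉ J (tgt c.1) ∧ c.2.2 ∈ J (src c.1))
  have h4 : ∑ a, ((J (tgt a))ᶜ ×ˢ (J (src a))).card ≤ ∑ x, (shearPairs (J x)).card := by
    have h6 : Fintype.card (Σ x, shearPairs (J x)) = ∑ x, (shearPairs (J x)).card := by
      rw [Fintype.card_sigma]
      exact Finset.sum_congr rfl fun x _ => Fintype.card_coe _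
    rw [Fintype.card_sigma] at h3
    omega
  have h5 : ∀ a, ((J (src a)).card : ℤ) * ((n (tgt a) : ℤ) - ((J (tgt a)).card : ℤ)) =
      (((J (tgt a))ᶜ ×ˢ (J (src a))).card : ℤ) := by
    intro a
    have := Finset.card_add_card_compl (J (tgt a))
    rw [Fintype.card_fin] at this
    rw [Finset.card_product]
    zify at this
    push_cast
    rw [← sub_eq_of_eq_add' this.symm]
    ring
  rw [Finset.sum_congr rfl fun a _ => h5 a]
  exact_mod_cast h4

end QRep

end Parametrization

section Jacobian

open MvPolynomial Topology in
/-- A polynomial map with surjective differential at some point is dominant. -/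
theorem eq_zero_of_surjective_deriv {σ τ : Type} [Fintype σ] [Fintype τ]
    (F : τ → MvPolynomial σ ℂ) (s₀ : σ → ℂ)
    (hF : ∀ T : τ → ℂ, ∃ s : σ → ℂ, ∀ c,
      HasDerivAt (fun t : ℂ => eval (s₀ + t • s) (F c)) (T c) 0)
    (p : MvPolynomial τ ℂ) (hp : ∀ s : σ → ℂ, eval (fun c => eval s (F c)) p = 0) : p = 0 := by
  let Φ : (σ → ℂ) → τ → ℂ := fun s c => eval s (F c)
  have hΦ : AnalyticAt ℂ Φ s₀ := by
    rw [analyticAt_pi_iff]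
    intro c
    have := AnalyticAt.aeval_mvPolynomial (𝕜 := ℂ) (f := fun s : σ → ℂ => s) (z := s₀)
      (fun i => (ContinuousLinearMap.proj (R := ℂ) (φ := fun _ : σ => ℂ) i).analyticAt s₀) (F c)
    simpa [Φ, aeval_eq_eval] using this
  have hstrict := hΦ.hasStrictFDerivAt
  have hsurj : (fderiv ℂ Φ s₀).range = ⊤ := by
    rw [LinearMap.range_eq_top]
    intro T
    obtain ⟨s, hs⟩ := hF T
    refine ⟨s, ?_⟩
    have h1 : HasDerivAt (fun t : ℂ => s₀ + t • s) s 0 := by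
      simpa using ((hasDerivAt_id (0 : ℂ)).smul_const s).const_add s₀
    have h2 : HasDerivAt (Φ ∘ fun t : ℂ => s₀ + t • s) (fderiv ℂ Φ s₀ s) 0 := by
      refine HasFDerivAt.comp_hasDerivAt (0 : ℂ) ?_ h1
      simpa using hstrict.hasFDerivAt
    exact h2.unique (hasDerivAt_pi.mpr hs)
  have hmap := hstrict.map_nhds_eq_of_surj hsurj
  have hmem : {r : τ → ℂ | eval r p = 0} ∈ 𝓝 (Φ s₀) := by
    rw [← hmap]
    exact Filter.mem_map.mpr (Filter.univ_mem' hp)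
  obtain ⟨ε, hε, hball⟩ := Metric.mem_nhds_iff.mp hmem
  refine funext_set (fun c => Metric.ball (Φ s₀ c) ε) (fun c => ?_) fun r hr => ?_
  · exact infinite_of_mem_nhds _ (Metric.ball_mem_nhds _ hε)
  · rw [map_zero]
    refine hball ?_
    rw [ball_pi _ hε]
    exact hr

variable {V A : Type} [Fintype V] [Fintype A] {src tgt : A → V} {n : V → ℕ}

namespace QRep

/-- Infinitesimal criterion for dominance. -/
theorem isDominant_of_surjective {J : ∀ x, Finset (Fin (n x))} {v : QRep src tgt n}
    (hv : v ∈ blockTri src tgt J)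
    (h : ∀ T : QRep src tgt n, ∃ θ : ∀ x, Matrix (Fin (n x)) (Fin (n x)) ℂ,
      (∀ x, IsShear (J x) (θ x)) ∧ ∀ a i j, i ∉ J (tgt a) → j ∈ J (src a) →
        (θ (tgt a) * v a - v a * θ (src a)) i j = T a i j) : IsDominant src tgt J := by
  intro p hp
  obtain ⟨s₀, hs₀, hs₀v⟩ := exists_param (θ := 0) (fun x i j hij => absurd rfl hij) hv
  refine eq_zero_of_surjective_deriv (genericPos (src := src) (tgt := tgt) J) s₀ ?_ p ?_
  · intro T
    obtain ⟨θ, hθ, hT⟩ := h (ofCoord T)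
    let u : QRep src tgt n := fun a => ofCoord T a - (θ (tgt a) * v a - v a * θ (src a))
    have hu : u ∈ blockTri src tgt J := by
      intro a i j hi hj
      simp only [u, Matrix.sub_apply _ (_ - _), hT a i j hi hj, sub_self]
    obtain ⟨s, hs, hsu⟩ := exists_param hθ hu
    refine ⟨s, fun c => ?_⟩
    have h1 : ∀ t : ℂ, (paramShear (s₀ + t • s) : ∀ x, Matrix (Fin (n x)) (Fin (n x)) ℂ) =
        t • θ := by
      intro t
      rw [← hs]
      ext x i j
      have := congrFun (congrFun (congrFun hs₀ x) i) j
      simp only [paramShear, Pi.smul_apply, Matrix.smul_apply] at this ⊢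
      split_ifs with hij
      · rw [dif_pos hij] at this
        simp [this]
      · simp
    have h2 : ∀ t : ℂ, (paramBlock (s₀ + t • s) : QRep src tgt n) = v + t • u := by
      intro t
      rw [← hs₀v, ← hsu]
      ext a i j
      simp only [paramBlock, Pi.add_apply, Pi.smul_apply, Matrix.add_apply, Matrix.smul_apply]
      split_ifs with hij <;> simp
    obtain ⟨a, i, j⟩ := c
    let B : Matrix (Fin (n (tgt a))) (Fin (n (src a))) ℂ :=
      θ (tgt a) * u a - u a * θ (src a) - θ (tgt a) * v a * θ (src a)
    let C : Matrix (Fin (n (tgt a))) (Fin (n (src a))) ℂ := θ (tgt a) * u a * θ (src a)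
    have h3 : ∀ t : ℂ, MvPolynomial.eval (s₀ + t • s) (genericPos J ⟨a, i, j⟩) =
        v a i j + t * T ⟨a, i, j⟩ + t ^ 2 * B i j - t ^ 3 * C i j := by
      intro t
      rw [eval_genericPos, h1, h2, coord, conj_apply]
      have : (1 + (t • θ) (tgt a)) * (v + t • u) a * (1 - (t • θ) (src a)) =
          v a + t • (u a + (θ (tgt a) * v a - v a * θ (src a))) + t ^ 2 • B - t ^ 3 • C := by
        simp only [Pi.smul_apply, Pi.add_apply, Matrix.add_mul, Matrix.mul_add, Matrix.mul_sub,
          Matrix.one_mul, Matrix.mul_one, Matrix.smul_mul, Matrix.mul_smul, B, C]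
        module
      rw [this]
      have hT' : u a + (θ (tgt a) * v a - v a * θ (src a)) = ofCoord T a := by simp [u]
      rw [hT']
      simp [ofCoord]
    simp only [h3]
    have h4 := ((((hasDerivAt_id (0 : ℂ)).mul_const (T ⟨a, i, j⟩)).const_add (v a i j)).add
      (((hasDerivAt_id (0 : ℂ)).pow 2).mul_const (B i j))).sub
      (((hasDerivAt_id (0 : ℂ)).pow 3).mul_const (C i j))
    exact h4.congr_deriv (by simp)
  · intro s
    have : (fun c => MvPolynomial.eval s (genericPos J c)) =
        (conj (paramShear s) (paramBlock s) : QRep src tgt n).coord :=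
      funext fun c => eval_genericPos s c
    rw [this]
    exact hp _ (hasPos_iff.mpr ⟨_, isShear_paramShear s, _, paramBlock_mem s, rfl⟩)

end QRep

end Jacobian

section Compactness

/-- A subspace has an orthonormal basis adapted to its position. -/
theorem exists_orthonormal_columns {n : ℕ} (N : Submodule ℂ (Fin n → ℂ)) {J : Finset (Fin n)}
    (hJ : leadingIndices N = J) :
    ∃ U : Matrix (Fin n) (Fin J.card) ℂ, Uᴴ * U = 1 ∧
      (∀ i j, (J.orderIsoOfFin rfl j : Fin n) < i → U i j = 0) ∧
      LinearMap.range (Matrix.mulVecLin U) = N := by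
  obtain ⟨θ, hθ, hN⟩ := exists_isShear N
  rw [hJ] at hθ hN
  set e : Fin J.card → Fin n := fun j => (J.orderIsoOfFin rfl j : Fin n) with he
  have heinj : Function.Injective e := fun i j h =>
    (J.orderIsoOfFin rfl).injective (Subtype.ext h)
  have hemono : ∀ i j, i ≤ j → e i ≤ e j := fun i j h => (J.orderIsoOfFin rfl).monotone h
  let w : Fin J.card → Fin n → ℂ := fun j => (1 + θ) *ᵥ Pi.single (e j) 1
  have hwinv : ∀ j, (1 - θ) *ᵥ w j = Pi.single (e j) 1 := fun j => by
    simp only [w, mulVec_mulVec, hθ.sub_mul_add, one_mulVec]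
  have hwN : ∀ j, w j ∈ N := by
    intro j
    rw [← hN, Submodule.mem_comap, mulVecLin_apply, hwinv]
    intro i hi
    exact Pi.single_eq_of_ne (fun h => hi (by rw [h]; exact (J.orderIsoOfFin rfl j).2)) _
  have hwz : ∀ j i, e j < i → w j i = 0 := by
    intro j i hij
    simp only [w, add_mulVec, one_mulVec, Pi.add_apply]
    rw [Pi.single_eq_of_ne hij.ne', zero_add, mulVec_single_one, col_apply]
    by_contra h
    exact absurd (hθ _ _ h).2.2 (not_lt.mpr hij.le)
  have hwli : LinearIndependent ℂ w := by
    apply LinearIndependent.of_comp (Matrix.mulVecLin (1 - θ))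
    have : (Matrix.mulVecLin (1 - θ)) ∘ w = (Pi.basisFun ℂ (Fin n)) ∘ e := by
      ext1 j
      simp only [Function.comp_apply, mulVecLin_apply, hwinv, Pi.basisFun_apply]
    rw [this]
    exact (Pi.basisFun ℂ (Fin n)).linearIndependent.comp _ heinj
  let T : (Fin n → ℂ) ≃ₗ[ℂ] EuclideanSpace ℂ (Fin n) := (WithLp.linearEquiv 2 ℂ (Fin n → ℂ)).symm
  let f : Fin J.card → EuclideanSpace ℂ (Fin n) := fun j => T (w j)
  have hfli : LinearIndependent ℂ f := hwli.map' T.toLinearMap T.ker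
  let g := InnerProductSpace.gramSchmidtNormed ℂ f
  have hg : Orthonormal ℂ g := InnerProductSpace.gramSchmidtNormed_orthonormal hfli
  have hgmem : ∀ j (P : Submodule ℂ (Fin n → ℂ)), (∀ j', j' ≤ j → w j' ∈ P) →
      T.symm (g j) ∈ P := by
    intro j P hP
    have h1 : g j ∈ Submodule.span ℂ (f '' Set.Iic j) :=
      Submodule.smul_mem _ _ (InnerProductSpace.gramSchmidt_mem_span ℂ f le_rfl)
    have h2 : Submodule.span ℂ (f '' Set.Iic j) ≤ P.comap T.symm.toLinearMap := by
      rw [Submodule.span_le]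
      rintro _ ⟨j', hj', rfl⟩
      simpa [f] using hP j' hj'
    exact h2 h1
  let U : Matrix (Fin n) (Fin J.card) ℂ := fun i j => T.symm (g j) i
  have hUU : Uᴴ * U = 1 := by
    ext i j
    rw [Matrix.mul_apply, Matrix.one_apply, ← orthonormal_iff_ite.mp hg i j, PiLp.inner_apply]
    refine Finset.sum_congr rfl fun k _ => ?_
    rw [conjTranspose_apply, RCLike.inner_apply, mul_comm]
    rfl
  have hle : LinearMap.range (Matrix.mulVecLin U) ≤ N := by
    rintro _ ⟨c, rfl⟩
    rw [mulVecLin_apply, mulVec_eq_sum]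
    refine N.sum_mem fun j _ => ?_
    rw [op_smul_eq_smul]
    exact N.smul_mem _ (hgmem j N fun j' _ => hwN j')
  refine ⟨U, hUU, fun i j hij => ?_, ?_⟩
  · refine hgmem j (LinearMap.ker (LinearMap.proj i)) fun j' hj' => ?_
    exact hwz j' i ((hemono _ _ hj').trans_lt hij)
  · refine Submodule.eq_of_le_of_finrank_eq hle ?_
    have hinj : Function.Injective (Matrix.mulVecLin U) := by
      intro a b hab
      have := congrArg (fun x => Uᴴ *ᵥ x) hab
      simpa [mulVec_mulVec, hUU] using this
    rw [LinearMap.finrank_range_of_inj hinj, finrank_eq_card_leadingIndices, hJ]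
    simp

theorem finrank_stdFlag {m t : ℕ} (h : t ≤ m) : Module.finrank ℂ (stdFlag m t) = t := by
  have : stdFlag m t = coordSubspace (Finset.univ.filter fun i : Fin m => (i : ℕ) < t) := by
    ext u
    simp [mem_stdFlag, mem_coordSubspace]
  rw [this, finrank_coordSubspace, Fin.card_filter_val_lt, min_eq_right h]

variable {V A : Type} {src tgt : A → V} {n : V → ℕ}

namespace QRep

/-- The representation has a subrepresentation, described by orthonormal bases, in the Schubert
variety of `J`. -/
def MeetsSchubert (r : QRep src tgt n) (J : ∀ x, Finset (Fin (n x))) : Prop :=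
  ∃ U : ∀ x, Matrix (Fin (n x)) (Fin (J x).card) ℂ, (∀ x, (U x)ᴴ * U x = 1) ∧
    (∀ x i j, ((J x).orderIsoOfFin rfl j : Fin (n x)) < i → U x i j = 0) ∧
    ∀ a, r a * U (src a) = U (tgt a) * ((U (tgt a))ᴴ * (r a * U (src a)))

theorem HasPos.meetsSchubert {r : QRep src tgt n} {J : ∀ x, Finset (Fin (n x))}
    (h : r.HasPos J) : r.MeetsSchubert J := by
  obtain ⟨N, hN, hJ⟩ := h
  choose U h1 h2 h3 using fun x => exists_orthonormal_columns (N x) (hJ x)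
  refine ⟨U, h1, h2, fun a => ?_⟩
  refine Matrix.mulVec_injective (funext fun c => ?_)
  have hmem : (r a * U (src a)) *ᵥ c ∈ N (tgt a) := by
    rw [← mulVec_mulVec]
    exact hN a _ (by rw [← h3]; exact ⟨c, rfl⟩)
  rw [← h3] at hmem
  obtain ⟨d, hd⟩ := hmem
  rw [mulVecLin_apply] at hd
  rw [← mulVec_mulVec c (U (tgt a)), ← mulVec_mulVec c (U (tgt a))ᴴ, ← hd,
    mulVec_mulVec _ (U (tgt a))ᴴ, h1, one_mulVec]

theorem isClosed_meetsSchubert (J : ∀ x, Finset (Fin (n x))) :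
    IsClosed {r : QRep src tgt n | r.MeetsSchubert J} := by
  let 𝒰 : Set (∀ x, Matrix (Fin (n x)) (Fin (J x).card) ℂ) :=
    Set.univ.pi fun x => Set.univ.pi fun i => Set.univ.pi fun j => Metric.closedBall 0 1
  have hc : IsCompact 𝒰 := isCompact_univ_pi fun x => isCompact_univ_pi fun i =>
    isCompact_univ_pi fun j => isCompact_closedBall _ _
  have : CompactSpace 𝒰 := isCompact_iff_compactSpace.mp hc
  let C : Set (QRep src tgt n × 𝒰) := {p | (∀ x, (p.2.1 x)ᴴ * p.2.1 x = 1) ∧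
    (∀ x i j, ((J x).orderIsoOfFin rfl j : Fin (n x)) < i → p.2.1 x i j = 0) ∧
    ∀ a, p.1 a * p.2.1 (src a) = p.2.1 (tgt a) * ((p.2.1 (tgt a))ᴴ * (p.1 a * p.2.1 (src a)))}
  have hU : ∀ x, Continuous fun p : QRep src tgt n × 𝒰 => p.2.1 x := fun x =>
    (continuous_apply x).comp (continuous_subtype_val.comp continuous_snd)
  have hr : ∀ a, Continuous fun p : QRep src tgt n × 𝒰 => p.1 a := fun a =>
    (continuous_apply a).comp continuous_fst
  have hC : IsClosed C := by
    simp only [C, Set.ofPred_and, Set.ofPred_forall]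
    refine IsClosed.inter ?_ (IsClosed.inter ?_ ?_)
    · refine isClosed_iInter fun x => isClosed_eq ?_ continuous_const
      exact (hU x).matrix_conjTranspose.matrix_mul (hU x)
    · refine isClosed_iInter fun x => isClosed_iInter fun i => isClosed_iInter fun j =>
        isClosed_iInter fun _ => isClosed_eq ?_ continuous_const
      exact (hU x).matrix_elem i j
    · refine isClosed_iInter fun a => isClosed_eq ((hr a).matrix_mul (hU _)) ?_
      exact (hU _).matrix_mul ((hU _).matrix_conjTranspose.matrix_mul ((hr a).matrix_mul (hU _)))
  convert isClosedMap_fst_of_compactSpace C hC using 1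
  ext r
  constructor
  · rintro ⟨U, h1, h2, h3⟩
    refine ⟨(r, ⟨U, fun x _ i _ j _ => ?_⟩), ⟨h1, h2, h3⟩, rfl⟩
    have h4 := congrFun (congrFun (h1 x) j) j
    rw [Matrix.mul_apply, Matrix.one_apply_eq] at h4
    have h5 : ∑ k, ‖U x k j‖ ^ 2 = 1 := by
      have h6 : ((∑ k, ‖U x k j‖ ^ 2 : ℝ) : ℂ) = 1 := by
        rw [← h4]
        push_cast
        exact Finset.sum_congr rfl fun k _ => (Complex.conj_mul' _).symm
      exact_mod_cast h6
    rw [mem_closedBall_zero_iff]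
    have h6 : ‖U x i j‖ ^ 2 ≤ 1 := h5 ▸ Finset.single_le_sum
      (f := fun k => ‖U x k j‖ ^ 2) (fun k _ => sq_nonneg _) (Finset.mem_univ i)
    exact (sq_le_one_iff₀ (norm_nonneg _)).mp h6
  · rintro ⟨⟨r', U⟩, ⟨h1, h2, h3⟩, rfl⟩
    exact ⟨U.1, h1, h2, h3⟩

theorem IsDominant.meetsSchubert [Finite V] [Finite A] {J : ∀ x, Finset (Fin (n x))}
    (h : IsDominant src tgt J) (r : QRep src tgt n) : r.MeetsSchubert J := by
  obtain ⟨g, hg0, hg⟩ := h.exists_forall_hasPos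
  obtain ⟨f, hf⟩ : ∃ f, MvPolynomial.eval f g ≠ 0 := by
    by_contra! hf
    exact hg0 (MvPolynomial.funext fun f => by rw [hf, map_zero])
  have hfin := IsLineOpen.eval_ne_zero g f hf r.coord
  let L : ℂ → QRep src tgt n := fun t => r + t • (ofCoord f - r)
  have hL : Continuous L := by fun_prop
  have hclosed : IsClosed (L ⁻¹' {r | r.MeetsSchubert J}) := (isClosed_meetsSchubert J).preimage hL
  have hdense : Dense (L ⁻¹' {r | r.MeetsSchubert J}) := by
    refine (hfin.countable.dense_compl ℂ).mono fun t ht => ?_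
    rw [Set.mem_compl_iff, Set.mem_ofPred_eq, not_not] at ht
    exact (hg (L t) ht).meetsSchubert
  have h0 : (0 : ℂ) ∈ L ⁻¹' {r | r.MeetsSchubert J} := by
    rw [← hclosed.closure_eq, hdense.closure_eq]
    exact Set.mem_univ _
  simpa [L] using h0

theorem IsDominant.isQIntersecting [Finite V] [Finite A] {J : ∀ x, Finset (Fin (n x))}
    (h : IsDominant src tgt J) : IsQIntersecting src tgt n J := by
  intro r
  obtain ⟨U, h1, h2, h3⟩ := h.meetsSchubert (fun a => LinearMap.toMatrix' (r a))
  have hinj : ∀ x, Function.Injective (Matrix.mulVecLin (U x)) := by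
    intro x a b hab
    have := congrArg (fun c => (U x)ᴴ *ᵥ c) hab
    simpa [mulVec_mulVec, h1] using this
  refine ⟨fun x => LinearMap.range (Matrix.mulVecLin (U x)), fun x => ?_, fun x j => ?_,
    fun a => ?_⟩
  · rw [LinearMap.finrank_range_of_inj (hinj x)]
    simp
  · have hle : (stdFlag (J x).card (j + 1)).map (Matrix.mulVecLin (U x)) ≤
        LinearMap.range (Matrix.mulVecLin (U x)) ⊓
          stdFlag (n x) (((J x).orderIsoOfFin rfl j : Fin (n x)) + 1) := by
      rintro _ ⟨c, hc, rfl⟩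
      refine ⟨⟨c, rfl⟩, fun i hi => ?_⟩
      rw [mulVecLin_apply, mulVec, dotProduct]
      refine Finset.sum_eq_zero fun k _ => ?_
      by_cases hk : (j : ℕ) + 1 ≤ k
      · rw [hc k hk, mul_zero]
      · rw [h2, zero_mul]
        refine lt_of_le_of_lt (b := ((J x).orderIsoOfFin rfl j : Fin (n x))) ?_ ?_
        · exact (J x).orderIsoOfFin rfl |>.monotone (by rw [Fin.le_def]; omega)
        · rw [Fin.lt_def]; omega
    have h4 := Submodule.finrank_mono hle
    rw [← (Submodule.equivMapOfInjective _ (hinj x) _).finrank_eq, finrank_stdFlag j.2] at h4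
    exact h4
  · rintro _ ⟨_, ⟨c, rfl⟩, rfl⟩
    refine ⟨((U (tgt a))ᴴ * (LinearMap.toMatrix' (r a) * U (src a))) *ᵥ c, ?_⟩
    rw [mulVecLin_apply, mulVec_mulVec, ← h3, ← mulVec_mulVec, LinearMap.toMatrix'_mulVec]
    rfl

end QRep

end Compactness

section RowMul

variable {W W' : Type} [AddCommGroup W] [Module ℂ W] [AddCommGroup W'] [Module ℂ W']
  {l m p : ℕ}

/-- The product of a row of vectors with a matrix. -/
def rowMul (φ : Fin l → W) (B : Matrix (Fin l) (Fin m) ℂ) : Fin m → W :=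
  fun j => ∑ i, B i j • φ i

theorem rowMul_apply (φ : Fin l → W) (B : Matrix (Fin l) (Fin m) ℂ) (j : Fin m) :
    rowMul φ B j = ∑ i, B i j • φ i := rfl

theorem rowMul_mul (φ : Fin l → W) (B : Matrix (Fin l) (Fin m) ℂ) (C : Matrix (Fin m) (Fin p) ℂ) :
    rowMul φ (B * C) = rowMul (rowMul φ B) C := by
  ext1 j
  simp only [rowMul_apply, Matrix.mul_apply, Finset.sum_smul, Finset.smul_sum, smul_smul]
  rw [Finset.sum_comm]
  exact Finset.sum_congr rfl fun _ _ => Finset.sum_congr rfl fun _ _ => by rw [mul_comm]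

theorem rowMul_one (φ : Fin l → W) : rowMul φ 1 = φ := by
  ext1 j
  simp [rowMul_apply, Matrix.one_apply]

theorem rowMul_one_add (φ : Fin l → W) (B : Matrix (Fin l) (Fin l) ℂ) (j : Fin l) :
    rowMul φ (1 + B) j = φ j + ∑ i, B i j • φ i := by
  simp [rowMul_apply, Matrix.add_apply, add_smul, Finset.sum_add_distrib, Matrix.one_apply]

theorem map_rowMul (f : W →ₗ[ℂ] W') (φ : Fin l → W) (B : Matrix (Fin l) (Fin m) ℂ) (j : Fin m) :
    f (rowMul φ B j) = rowMul (fun i => f (φ i)) B j := by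
  simp [rowMul_apply]

theorem rowMul_mulVec (φ : Fin l → W) (B : Matrix (Fin l) (Fin m) ℂ) (u : Fin m → ℂ) :
    ∑ i, (B *ᵥ u) i • φ i = ∑ j, u j • rowMul φ B j := by
  simp only [rowMul_apply, Matrix.mulVec, dotProduct, Finset.sum_smul, Finset.smul_sum, smul_smul]
  rw [Finset.sum_comm]
  exact Finset.sum_congr rfl fun _ _ => Finset.sum_congr rfl fun _ _ => by rw [mul_comm]

end RowMul

section Coupling

variable {V A : Type} {src tgt : A → V} {k : V → ℕ}
  {W : V → Type} [∀ x, AddCommGroup (W x)] [∀ x, Module ℂ (W x)]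

namespace QRep

/-- Rows of vectors supported on `L`, with entries in prescribed subspaces. -/
def rowSpace (F : ∀ x, Fin (k x) → Submodule ℂ (W x)) (L : ∀ x, Finset (Fin (k x))) :
    Submodule ℂ (∀ x, Fin (k x) → W x) :=
  Submodule.pi Set.univ fun x => Submodule.pi Set.univ fun j => if j ∈ L x then F x j else ⊥

theorem mem_rowSpace {F : ∀ x, Fin (k x) → Submodule ℂ (W x)} {L : ∀ x, Finset (Fin (k x))}
    {ψ : ∀ x, Fin (k x) → W x} :
    ψ ∈ rowSpace F L ↔ ∀ x j, (j ∈ L x → ψ x j ∈ F x j) ∧ (j ∉ L x → ψ x j = 0) := by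
  simp only [rowSpace, Submodule.mem_pi, Set.mem_univ, true_implies]
  refine forall_congr' fun x => forall_congr' fun j => ?_
  split_ifs with h <;> simp [h]

theorem rowSpace_mono {F : ∀ x, Fin (k x) → Submodule ℂ (W x)} {L M : ∀ x, Finset (Fin (k x))}
    (h : ∀ x, M x ⊆ L x) : rowSpace F M ≤ rowSpace F L := by
  intro ψ hψ
  rw [mem_rowSpace] at hψ ⊢
  intro x j
  refine ⟨fun _ => ?_, fun hj => (hψ x j).2 fun hj' => hj (h x hj')⟩
  by_cases hj : j ∈ M x
  · exact (hψ x j).1 hj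
  · rw [(hψ x j).2 hj]
    exact Submodule.zero_mem _

variable (src tgt W) in
/-- The target of the coupling maps. -/
def obsSpace (L : ∀ x, Finset (Fin (k x))) :
    Submodule ℂ (∀ a, Fin (k (src a)) → W (tgt a)) :=
  Submodule.pi Set.univ fun a => Submodule.pi Set.univ fun j => if j ∈ L (src a) then ⊤ else ⊥

theorem mem_obsSpace {L : ∀ x, Finset (Fin (k x))} {T : ∀ a, Fin (k (src a)) → W (tgt a)} :
    T ∈ obsSpace src tgt W L ↔ ∀ a j, j ∉ L (src a) → T a j = 0 := by
  simp only [obsSpace, Submodule.mem_pi, Set.mem_univ, true_implies]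
  refine forall_congr' fun x => forall_congr' fun j => ?_
  split_ifs with h <;> simp [h]

theorem finrank_submodule_pi {ι : Type} [Fintype ι] {E : ι → Type} [∀ i, AddCommGroup (E i)]
    [∀ i, Module ℂ (E i)] [∀ i, FiniteDimensional ℂ (E i)] (p : ∀ i, Submodule ℂ (E i)) :
    Module.finrank ℂ (Submodule.pi Set.univ p) = ∑ i, Module.finrank ℂ (p i) := by
  let e : Submodule.pi Set.univ p ≃ₗ[ℂ] ∀ i, p i :=
    { toFun := fun u i => ⟨u.1 i, u.2 i trivial⟩
      map_add' := fun _ _ => rfl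
      map_smul' := fun _ _ => rfl
      invFun := fun u => ⟨fun i => u i, fun i _ => (u i).2⟩
      left_inv := fun _ => rfl
      right_inv := fun _ => rfl }
  rw [e.finrank_eq, Module.finrank_pi_fintype]

theorem finrank_rowSpace [Fintype V] [∀ x, FiniteDimensional ℂ (W x)]
    (F : ∀ x, Fin (k x) → Submodule ℂ (W x)) (L : ∀ x, Finset (Fin (k x))) :
    Module.finrank ℂ (rowSpace F L) = ∑ x, ∑ j ∈ L x, Module.finrank ℂ (F x j) := by
  rw [rowSpace, finrank_submodule_pi]
  refine Finset.sum_congr rfl fun x _ => ?_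
  rw [finrank_submodule_pi, ← Finset.sum_filter_add_sum_filter_not Finset.univ (· ∈ L x),
    Finset.filter_mem_eq_inter, Finset.univ_inter,
    Finset.sum_congr rfl fun j hj => by rw [if_pos hj],
    Finset.sum_eq_zero (s := Finset.univ.filter _), add_zero]
  intro j hj
  rw [if_neg (by simpa using hj), finrank_bot]

theorem finrank_obsSpace [Fintype A] [∀ x, FiniteDimensional ℂ (W x)]
    (L : ∀ x, Finset (Fin (k x))) :
    Module.finrank ℂ (obsSpace src tgt W L) =
      ∑ a, (L (src a)).card * Module.finrank ℂ (W (tgt a)) := by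
  rw [obsSpace, finrank_submodule_pi]
  refine Finset.sum_congr rfl fun a _ => ?_
  rw [finrank_submodule_pi, ← Finset.sum_filter_add_sum_filter_not Finset.univ (· ∈ L (src a)),
    Finset.filter_mem_eq_inter, Finset.univ_inter,
    Finset.sum_congr rfl fun j hj => by rw [if_pos hj, finrank_top],
    Finset.sum_eq_zero (s := Finset.univ.filter _), add_zero, Finset.sum_const, smul_eq_mul]
  intro j hj
  rw [if_neg (by simpa using hj), finrank_bot]

/-- The map `ψ ↦ ψ v - w ψ`, truncated to the columns in `L`. -/
def coupling (L : ∀ x, Finset (Fin (k x))) (v : QRep src tgt k)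
    (w : ∀ a, W (src a) →ₗ[ℂ] W (tgt a)) :
    (∀ x, Fin (k x) → W x) →ₗ[ℂ] ∀ a, Fin (k (src a)) → W (tgt a) where
  toFun ψ a j := if j ∈ L (src a) then rowMul (ψ (tgt a)) (v a) j - w a (ψ (src a) j) else 0
  map_add' ψ ψ' := by
    ext a j
    simp only [Pi.add_apply]
    split_ifs
    · simp only [rowMul_apply, Pi.add_apply, smul_add, Finset.sum_add_distrib, map_add]
      abel
    · simp
  map_smul' c ψ := by
    ext a j
    simp only [Pi.smul_apply, RingHom.id_apply]
    split_ifs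
    · simp only [rowMul_apply, Pi.smul_apply, smul_comm _ c, map_smul, smul_sub, Finset.smul_sum]
    · simp

theorem coupling_apply_of_mem {L : ∀ x, Finset (Fin (k x))} (v : QRep src tgt k)
    (w : ∀ a, W (src a) →ₗ[ℂ] W (tgt a)) (ψ : ∀ x, Fin (k x) → W x) {a : A} {j : Fin (k (src a))}
    (hj : j ∈ L (src a)) :
    coupling L v w ψ a j = rowMul (ψ (tgt a)) (v a) j - w a (ψ (src a) j) := if_pos hj

theorem coupling_apply_of_notMem {L : ∀ x, Finset (Fin (k x))} (v : QRep src tgt k)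
    (w : ∀ a, W (src a) →ₗ[ℂ] W (tgt a)) (ψ : ∀ x, Fin (k x) → W x) {a : A} {j : Fin (k (src a))}
    (hj : j ∉ L (src a)) : coupling L v w ψ a j = 0 := if_neg hj

theorem coupling_add_smul (L : ∀ x, Finset (Fin (k x))) (v v' : QRep src tgt k)
    (w w' : ∀ a, W (src a) →ₗ[ℂ] W (tgt a)) (t : ℂ) :
    coupling L (v + t • v') (w + t • w') = coupling L v w + t • coupling L v' w' := by
  refine LinearMap.ext fun ψ => ?_
  ext a j
  by_cases hj : j ∈ L (src a)
  · simp only [LinearMap.add_apply, LinearMap.smul_apply, Pi.add_apply, Pi.smul_apply,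
      coupling_apply_of_mem _ _ _ hj, rowMul_apply, Matrix.add_apply, Matrix.smul_apply, add_smul,
      Finset.sum_add_distrib, smul_sub, Finset.smul_sum, smul_assoc]
    abel
  · simp only [LinearMap.add_apply, LinearMap.smul_apply, Pi.add_apply, Pi.smul_apply,
      coupling_apply_of_notMem _ _ _ hj, smul_zero, add_zero]

/-- The coupling map on rows with entries in `F`. -/
def couplingOn (F : ∀ x, Fin (k x) → Submodule ℂ (W x)) (L : ∀ x, Finset (Fin (k x)))
    (v : QRep src tgt k) (w : ∀ a, W (src a) →ₗ[ℂ] W (tgt a)) :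
    rowSpace F L →ₗ[ℂ] ∀ a, Fin (k (src a)) → W (tgt a) :=
  (coupling L v w).domRestrict (rowSpace F L)

theorem couplingOn_add_smul (F : ∀ x, Fin (k x) → Submodule ℂ (W x))
    (L : ∀ x, Finset (Fin (k x))) (v v' : QRep src tgt k)
    (w w' : ∀ a, W (src a) →ₗ[ℂ] W (tgt a)) (t : ℂ) :
    couplingOn F L (v + t • v') (w + t • w') = couplingOn F L v w + t • couplingOn F L v' w' := by
  rw [couplingOn, coupling_add_smul]
  rfl

theorem range_couplingOn_le (F : ∀ x, Fin (k x) → Submodule ℂ (W x))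
    (L : ∀ x, Finset (Fin (k x))) (v : QRep src tgt k) (w : ∀ a, W (src a) →ₗ[ℂ] W (tgt a)) :
    LinearMap.range (couplingOn F L v w) ≤ obsSpace src tgt W L := by
  rintro _ ⟨ψ, rfl⟩
  rw [mem_obsSpace]
  exact fun a j hj => coupling_apply_of_notMem _ _ _ hj

/-- The coupling map only depends on the `L × L` block of `v`. -/
theorem couplingOn_congr {F : ∀ x, Fin (k x) → Submodule ℂ (W x)}
    {L : ∀ x, Finset (Fin (k x))} {v v' : QRep src tgt k} (w : ∀ a, W (src a) →ₗ[ℂ] W (tgt a))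
    (h : ∀ a i j, i ∈ L (tgt a) → j ∈ L (src a) → v a i j = v' a i j) :
    couplingOn F L v w = couplingOn F L v' w := by
  refine LinearMap.ext fun ψ => ?_
  ext a j
  change coupling L v w ψ a j = coupling L v' w ψ a j
  by_cases hj : j ∈ L (src a)
  · rw [coupling_apply_of_mem _ _ _ hj, coupling_apply_of_mem _ _ _ hj, rowMul_apply, rowMul_apply]
    congr 1
    refine Finset.sum_congr rfl fun i _ => ?_
    by_cases hi : i ∈ L (tgt a)
    · rw [h a i j hi hj]
    · rw [(mem_rowSpace.mp ψ.2 _ i).2 hi, smul_zero, smul_zero]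
  · rw [coupling_apply_of_notMem _ _ _ hj, coupling_apply_of_notMem _ _ _ hj]

end QRep

end Coupling

section Generic

variable {V A : Type} {src tgt : A → V} {k : V → ℕ}
  {W : V → Type} [∀ x, AddCommGroup (W x)] [∀ x, Module ℂ (W x)]

theorem LinearIndepOn.exists_linearMap {ι W₁ W₂ : Type*} [AddCommGroup W₁] [Module ℂ W₁]
    [AddCommGroup W₂] [Module ℂ W₂] {φ : ι → W₁} {s : Set ι} (h : LinearIndepOn ℂ φ s)
    (f : ι → W₂) : ∃ g : W₁ →ₗ[ℂ] W₂, ∀ i ∈ s, g (φ i) = f i := by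
  replace h : LinearIndependent ℂ fun i : s => φ i := h
  obtain ⟨g, hg⟩ := ((Module.Basis.span h).constr ℂ fun i => f i).exists_extend
  refine ⟨g, fun i hi => ?_⟩
  have h1 := LinearMap.congr_fun hg (Module.Basis.span h ⟨i, hi⟩)
  rw [Module.Basis.constr_basis, LinearMap.comp_apply, Submodule.subtype_apply,
    Module.Basis.span_apply] at h1
  exact h1

namespace QRep

variable {F : ∀ x, Fin (k x) → Submodule ℂ (W x)} {L M : ∀ x, Finset (Fin (k x))}

theorem isLineOpen_le_finrank_range_couplingOn [Finite V] [Finite A]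
    [∀ x, FiniteDimensional ℂ (W x)] (F : ∀ x, Fin (k x) → Submodule ℂ (W x))
    (L : ∀ x, Finset (Fin (k x))) (ρ : ℕ) :
    IsLineOpen {p : QRep src tgt k × (∀ a, W (src a) →ₗ[ℂ] W (tgt a)) |
      ρ ≤ Module.finrank ℂ (LinearMap.range (couplingOn F L p.1 p.2))} := by
  intro p hp q
  have h1 : couplingOn F L (p.1 - q.1) (p.2 - q.2) =
      couplingOn F L p.1 p.2 - couplingOn F L q.1 q.2 := by
    have h := couplingOn_add_smul F L q.1 (p.1 - q.1) q.2 (p.2 - q.2) 1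
    rw [one_smul, one_smul, add_sub_cancel, add_sub_cancel, one_smul] at h
    rw [h, add_sub_cancel_left]
  refine (IsLineOpen.le_finrank_range ρ (couplingOn F L p.1 p.2) hp
    (couplingOn F L q.1 q.2)).subset fun t ht => ?_
  have h2 := couplingOn_add_smul F L q.1 (p.1 - q.1) q.2 (p.2 - q.2) t
  rw [h1] at h2
  rw [Set.mem_ofPred_eq, ← h2]
  exact ht

theorem isLineOpen_le_finrank_range_couplingOn_left [Finite V] [Finite A]
    [∀ x, FiniteDimensional ℂ (W x)] (F : ∀ x, Fin (k x) → Submodule ℂ (W x))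
    (L : ∀ x, Finset (Fin (k x))) (w : ∀ a, W (src a) →ₗ[ℂ] W (tgt a)) (ρ : ℕ) :
    IsLineOpen {v : QRep src tgt k |
      ρ ≤ Module.finrank ℂ (LinearMap.range (couplingOn F L v w))} :=
  (isLineOpen_le_finrank_range_couplingOn F L ρ).preimage (fun v => (v, w)) fun v v' t => by
    ext1
    · rfl
    · change w = w + t • (w - w)
      rw [sub_self, smul_zero, add_zero]

theorem exists_mem_rowSpace_of_obsSpace_le {v : QRep src tgt k}
    {w : ∀ a, W (src a) →ₗ[ℂ] W (tgt a)}
    (hM : obsSpace src tgt W M ≤ LinearMap.range (couplingOn F M v w))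
    (T : ∀ a, Fin (k (src a)) → W (tgt a)) :
    ∃ ψ ∈ rowSpace F M, ∀ a, ∀ j ∈ M (src a),
      rowMul (ψ (tgt a)) (v a) j - w a (ψ (src a) j) = T a j := by
  classical
  obtain ⟨ψ, hψ⟩ := @hM (fun a j => if j ∈ M (src a) then T a j else 0)
    (mem_obsSpace.mpr fun a j hj => if_neg hj)
  refine ⟨ψ, ψ.2, fun a j hj => ?_⟩
  rw [← coupling_apply_of_mem v w _ hj]
  refine (congr_fun (congr_fun hψ a) j).trans (if_pos hj)

/-- A coupling map that is surjective over `M` and of maximal rank over `L` becomes surjective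
over `L` if it has an element of the kernel which is independent on `L \ M`. -/
theorem obsSpace_le_range_of_mem_ker [Finite V] [Finite A] [∀ x, FiniteDimensional ℂ (W x)]
    (hML : ∀ x, M x ⊆ L x) {v : QRep src tgt k} {w : ∀ a, W (src a) →ₗ[ℂ] W (tgt a)}
    (hmax : ∀ w', Module.finrank ℂ (LinearMap.range (couplingOn F L v w')) ≤
      Module.finrank ℂ (LinearMap.range (couplingOn F L v w)))
    (hM : obsSpace src tgt W M ≤ LinearMap.range (couplingOn F M v w))
    {φ : ∀ x, Fin (k x) → W x} (hφ : φ ∈ rowSpace F L) (hker : coupling L v w φ = 0)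
    (hzero : ∀ x, ∀ j ∈ M x, φ x j = 0)
    (hind : ∀ x, LinearIndepOn ℂ (φ x) (L x \ M x : Set (Fin (k x)))) :
    obsSpace src tgt W L ≤ LinearMap.range (couplingOn F L v w) := by
  classical
  intro T hT
  obtain ⟨ψ, hψ, hψT⟩ := exists_mem_rowSpace_of_obsSpace_le hM T
  have hη : ∀ a, ∃ g : W (src a) →ₗ[ℂ] W (tgt a), ∀ j ∈ (L (src a) \ M (src a) : Set (Fin _)),
      g (φ (src a) j) = coupling L v w ψ a j - T a j :=
    fun a => (hind (src a)).exists_linearMap _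
  choose η hη using hη
  have hpencil := mem_range_of_finrank_range_le (couplingOn F L v w) (couplingOn F L 0 η)
    (fun t => by
      rw [← couplingOn_add_smul, smul_zero, add_zero]
      exact hmax _) ⟨φ, hφ⟩ hker
  have hsum : T = couplingOn F L v w ⟨ψ, rowSpace_mono hML hψ⟩ +
      couplingOn F L 0 η ⟨φ, hφ⟩ := by
    ext a j
    change T a j = coupling L v w ψ a j + coupling L 0 η φ a j
    by_cases hj : j ∈ L (src a)
    · rw [coupling_apply_of_mem 0 _ _ hj]
      have h0 : rowMul (φ (tgt a)) ((0 : QRep src tgt k) a) j = 0 := by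
        simp [rowMul_apply]
      rw [h0, zero_sub]
      by_cases hj' : j ∈ M (src a)
      · rw [hzero _ _ hj', map_zero, neg_zero, add_zero, coupling_apply_of_mem _ _ _ hj,
          hψT a j hj']
      · rw [hη a j ⟨hj, hj'⟩]
        abel
    · rw [coupling_apply_of_notMem _ _ _ hj, coupling_apply_of_notMem _ _ _ hj,
        mem_obsSpace.mp hT a j hj, add_zero]
  rw [hsum]
  exact add_mem ⟨_, rfl⟩ hpencil

end QRep

end Generic

section Relations

variable {W : Type*} [AddCommGroup W] [Module ℂ W] {m : ℕ}

/-- The linear relations between the vectors `φ j`, `j ∈ L`. -/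
noncomputable def relSpace (L : Finset (Fin m)) (φ : Fin m → W) : Submodule ℂ (Fin m → ℂ) :=
  coordSubspace L ⊓ LinearMap.ker (Fintype.linearCombination ℂ φ)

theorem mem_relSpace {L : Finset (Fin m)} {φ : Fin m → W} {u : Fin m → ℂ} :
    u ∈ relSpace L φ ↔ u ∈ coordSubspace L ∧ ∑ j, u j • φ j = 0 := by
  rw [relSpace, Submodule.mem_inf, LinearMap.mem_ker, Fintype.linearCombination_apply]

theorem linearIndepOn_relSpace (L : Finset (Fin m)) (φ : Fin m → W) :
    LinearIndepOn ℂ φ (L \ leadingIndices (relSpace L φ) : Set (Fin m)) := by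
  classical
  rw [← Finset.coe_sdiff, linearIndepOn_finset_iff]
  intro f hf
  by_contra! hne
  set D := L \ leadingIndices (relSpace L φ) with hD
  let u : Fin m → ℂ := fun j => if j ∈ D then f j else 0
  have hu : u ∈ relSpace L φ := by
    rw [mem_relSpace]
    constructor
    · intro i hi
      exact if_neg fun h => hi (Finset.mem_sdiff.mp h).1
    · simpa [u, ite_smul] using hf
  have hu0 : u ≠ 0 := by
    obtain ⟨i, hi, hfi⟩ := hne
    intro h
    apply hfi
    simpa [u, hi] using congr_fun h i
  obtain ⟨i, hi, hlead⟩ := exists_leading_of_ne_zero hu0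
  have hiD : i ∈ D := by
    by_contra h
    exact hi (if_neg h)
  exact (Finset.mem_sdiff.mp hiD).2 (mem_leadingIndices.mpr ⟨u, hu, hi, hlead⟩)

theorem leadingIndices_relSpace_subset (L : Finset (Fin m)) (φ : Fin m → W) :
    leadingIndices (relSpace L φ) ⊆ L :=
  leadingIndices_subset_of_le_coordSubspace inf_le_left

end Relations

section Degeneration

variable {V A : Type} {src tgt : A → V} {k : V → ℕ}
  {W : V → Type} [∀ x, AddCommGroup (W x)] [∀ x, Module ℂ (W x)]

namespace QRep

variable {F : ∀ x, Fin (k x) → Submodule ℂ (W x)} {L M : ∀ x, Finset (Fin (k x))}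

theorem obsSpace_le_range_iff [Finite V] [Finite A] [∀ x, FiniteDimensional ℂ (W x)]
    {v : QRep src tgt k} {w : ∀ a, W (src a) →ₗ[ℂ] W (tgt a)} :
    obsSpace src tgt W L ≤ LinearMap.range (couplingOn F L v w) ↔
      Module.finrank ℂ (obsSpace src tgt W L) ≤
        Module.finrank ℂ (LinearMap.range (couplingOn F L v w)) :=
  ⟨fun h => Submodule.finrank_mono h, fun h =>
    (Submodule.eq_of_le_of_finrank_le (range_couplingOn_le F L v w) h).ge⟩

theorem exists_replace_block [Finite V] [Finite A] [∀ x, FiniteDimensional ℂ (W x)]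
    (F : ∀ x, Fin (k x) → Submodule ℂ (W x)) (L : ∀ x, Finset (Fin (k x)))
    (v : QRep src tgt k) {v' : QRep src tgt k} {w : ∀ a, W (src a) →ₗ[ℂ] W (tgt a)}
    (hM : obsSpace src tgt W M ≤ LinearMap.range (couplingOn F M v' w)) :
    ∃ v'' : QRep src tgt k, (∀ a i j, i ∉ M (tgt a) → v'' a i j = v a i j) ∧
      obsSpace src tgt W M ≤ LinearMap.range (couplingOn F M v'' w) ∧
      Module.finrank ℂ (LinearMap.range (couplingOn F L v w)) ≤
        Module.finrank ℂ (LinearMap.range (couplingOn F L v'' w)) := by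
  classical
  let v₂ : QRep src tgt k := fun a i j =>
    if i ∈ M (tgt a) ∧ j ∈ M (src a) then v' a i j else v a i j
  let f : ℂ → QRep src tgt k := fun t => v₂ + t • (v - v₂)
  have hf : ∀ x y (t : ℂ), f (y + t • (x - y)) = f y + t • (f x - f y) := by
    intro x y t
    simp only [f]
    module
  have hf0 : f 0 = v₂ := by simp [f]
  have hf1 : f 1 = v := by simp [f]
  obtain ⟨t, ht1, ht2⟩ := ((isLineOpen_le_finrank_range_couplingOn_left F M w
    (Module.finrank ℂ (obsSpace src tgt W M))).preimage f hf).inter_nonempty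
    ((isLineOpen_le_finrank_range_couplingOn_left F L w
    (Module.finrank ℂ (LinearMap.range (couplingOn F L v w)))).preimage f hf)
    ⟨0, by
      rw [Set.mem_preimage, Set.mem_ofPred_eq, ← obsSpace_le_range_iff, hf0,
        couplingOn_congr (v := v₂) (v' := v') w fun a i j hi hj => if_pos ⟨hi, hj⟩]
      exact hM⟩
    ⟨1, by rw [Set.mem_preimage, Set.mem_ofPred_eq, hf1]⟩
  refine ⟨f t, fun a i j hi => ?_, obsSpace_le_range_iff.mpr ht1, ht2⟩
  have h : v₂ a i j = v a i j := if_neg fun h => hi h.1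
  simp [f, h]

theorem stable_relSpace {v : QRep src tgt k} (hv : v ∈ blockTri src tgt L)
    {w : ∀ a, W (src a) →ₗ[ℂ] W (tgt a)} {φ : ∀ x, Fin (k x) → W x}
    (hker : ∀ a, ∀ j ∈ L (src a), rowMul (φ (tgt a)) (v a) j = w a (φ (src a) j)) :
    v.Stable fun x => relSpace (L x) (φ x) := by
  intro a u hu
  rw [mem_relSpace] at hu ⊢
  refine ⟨stable_coordSubspace_iff.mpr hv a u hu.1, ?_⟩
  rw [rowMul_mulVec]
  have h : ∀ j, u j • rowMul (φ (tgt a)) (v a) j = u j • w a (φ (src a) j) := by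
    intro j
    by_cases hj : j ∈ L (src a)
    · rw [hker a j hj]
    · rw [hu.1 j hj, zero_smul, zero_smul]
  simp_rw [h, ← map_smul, ← map_sum, hu.2, map_zero]

/-- Row multiplication by a shear intertwines the coupling maps. -/
theorem coupling_conj {v : QRep src tgt k} {w : ∀ a, W (src a) →ₗ[ℂ] W (tgt a)}
    {θ : ∀ x, Matrix (Fin (k x)) (Fin (k x)) ℂ} (hθ : ∀ x, IsShear (M x) (θ x))
    (hML : ∀ x, M x ⊆ L x) (hθL : ∀ x i j, θ x i j ≠ 0 → i ∈ L x) (ψ : ∀ x, Fin (k x) → W x) :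
    coupling L (conj (-θ) v) w (fun x => rowMul (ψ x) (1 + θ x)) =
      fun a => rowMul (coupling L v w ψ a) (1 + θ (src a)) := by
  ext a j
  by_cases hj : j ∈ L (src a)
  · rw [coupling_apply_of_mem _ _ _ hj, ← rowMul_mul, conj_apply, Pi.neg_apply, Pi.neg_apply,
      sub_neg_eq_add, ← sub_eq_add_neg, ← Matrix.mul_assoc, ← Matrix.mul_assoc,
      (hθ _).add_mul_sub, Matrix.one_mul, map_rowMul, rowMul_mul, rowMul_one_add, rowMul_one_add,
      rowMul_one_add, coupling_apply_of_mem _ _ _ hj, add_sub_add_comm, ← Finset.sum_sub_distrib]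
    congr 1
    refine Finset.sum_congr rfl fun i _ => ?_
    rw [← smul_sub]
    by_cases hi : θ (src a) i j = 0
    · rw [hi, zero_smul, zero_smul]
    · rw [coupling_apply_of_mem _ _ _ (hθL _ _ _ hi)]
  · rw [coupling_apply_of_notMem _ _ _ hj, rowMul_one_add, coupling_apply_of_notMem _ _ _ hj,
      Finset.sum_eq_zero, add_zero]
    intro i _
    by_contra h
    exact hj (hML _ (hθ _ i j (left_ne_zero_of_smul h)).2.1)

theorem rowMul_mem_rowSpace (hF : ∀ x i j, i ≤ j → F x i ≤ F x j)
    {θ : ∀ x, Matrix (Fin (k x)) (Fin (k x)) ℂ} (hθ : ∀ x, IsShear (M x) (θ x))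
    (hML : ∀ x, M x ⊆ L x) {ψ : ∀ x, Fin (k x) → W x}
    (hψ : ψ ∈ rowSpace F L) : (fun x => rowMul (ψ x) (1 + θ x)) ∈ rowSpace F L := by
  rw [mem_rowSpace] at hψ ⊢
  intro x j
  rw [rowMul_one_add]
  constructor
  · intro hj
    refine add_mem ((hψ x j).1 hj) (sum_mem fun i _ => ?_)
    by_cases hi : θ x i j = 0
    · rw [hi, zero_smul]
      exact zero_mem _
    · refine Submodule.smul_mem _ _ ?_
      by_cases hiL : i ∈ L x
      · exact hF x i j (hθ x i j hi).2.2.le ((hψ x i).1 hiL)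
      · rw [(hψ x i).2 hiL]
        exact zero_mem _
  · intro hj
    rw [(hψ x j).2 hj, zero_add]
    refine Finset.sum_eq_zero fun i _ => ?_
    by_contra h
    exact hj (hML _ (hθ _ i j (left_ne_zero_of_smul h)).2.1)

theorem finrank_range_couplingOn_le_conj [Finite V] [Finite A]
    [∀ x, FiniteDimensional ℂ (W x)] (hF : ∀ x i j, i ≤ j → F x i ≤ F x j)
    (v : QRep src tgt k) (w : ∀ a, W (src a) →ₗ[ℂ] W (tgt a))
    {θ : ∀ x, Matrix (Fin (k x)) (Fin (k x)) ℂ} (hθ : ∀ x, IsShear (M x) (θ x))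
    (hML : ∀ x, M x ⊆ L x) (hθL : ∀ x i j, θ x i j ≠ 0 → i ∈ L x) :
    Module.finrank ℂ (LinearMap.range (couplingOn F L v w)) ≤
      Module.finrank ℂ (LinearMap.range (couplingOn F L (conj (-θ) v) w)) := by
  let R : (∀ a, Fin (k (src a)) → W (tgt a)) →ₗ[ℂ] (∀ a, Fin (k (src a)) → W (tgt a)) :=
    { toFun := fun T a => rowMul (T a) (1 + θ (src a))
      map_add' := fun T T' => by
        ext a j
        simp [rowMul_apply, Finset.sum_add_distrib]
      map_smul' := fun c T => by
        ext a j
        simp [rowMul_apply, Finset.smul_sum, smul_comm c] }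
  have hR : Function.Injective R := by
    intro T T' h
    ext1 a
    have h1 := congr_arg (fun T => rowMul T (1 - θ (src a))) (congr_fun h a)
    change rowMul (rowMul (T a) _) _ = rowMul (rowMul (T' a) _) _ at h1
    rwa [← rowMul_mul, ← rowMul_mul, (hθ _).add_mul_sub, rowMul_one, rowMul_one] at h1
  rw [← LinearMap.finrank_range_of_inj
    (f := R.domRestrict (LinearMap.range (couplingOn F L v w))) fun _ _ h => Subtype.ext (hR h)]
  refine Submodule.finrank_mono ?_
  rintro _ ⟨⟨_, ψ, rfl⟩, rfl⟩
  exact ⟨⟨_, rowMul_mem_rowSpace hF hθ hML ψ.2⟩, coupling_conj hθ hML hθL ψ.1⟩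

/-- A nonzero element of the kernel of a coupling map either cuts out a smaller position, or can
be used to extend surjectivity. -/
theorem exists_smaller_position [Finite V] [Finite A] [∀ x, FiniteDimensional ℂ (W x)]
    (hF : ∀ x i j, i ≤ j → F x i ≤ F x j) {v : QRep src tgt k} (hv : v ∈ blockTri src tgt L)
    {w : ∀ a, W (src a) →ₗ[ℂ] W (tgt a)}
    (hmax : ∀ (v' : QRep src tgt k) w', Module.finrank ℂ (LinearMap.range (couplingOn F L v' w')) ≤
      Module.finrank ℂ (LinearMap.range (couplingOn F L v w)))
    (hL : ∀ v', ¬ obsSpace src tgt W L ≤ LinearMap.range (couplingOn F L v' w))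
    {φ : ∀ x, Fin (k x) → W x} (hφ : φ ∈ rowSpace F L) (hφ0 : φ ≠ 0)
    (hker : coupling L v w φ = 0) :
    ∃ M : ∀ x, Finset (Fin (k x)), (∀ x, M x ⊆ L x) ∧ M ≠ L ∧ v.HasPos M ∧
      ∀ v', ¬ obsSpace src tgt W M ≤ LinearMap.range (couplingOn F M v' w) := by
  have hker' : ∀ a, ∀ j ∈ L (src a), rowMul (φ (tgt a)) (v a) j = w a (φ (src a) j) := by
    intro a j hj
    rw [← sub_eq_zero, ← coupling_apply_of_mem _ _ _ hj, hker]
    rfl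
  have hN := stable_relSpace hv hker'
  set M := fun x => leadingIndices (relSpace (L x) (φ x)) with hMdef
  have hML : ∀ x, M x ⊆ L x := fun x => leadingIndices_relSpace_subset _ _
  obtain ⟨θ, hθ, hθN, -⟩ := hN.exists_shear (J := M) fun _ => rfl
  have hcol : ∀ x, ∀ j ∈ M x, (1 + θ x) *ᵥ Pi.single j 1 ∈ relSpace (L x) (φ x) := by
    intro x j hj
    rw [← hθN x, Submodule.mem_comap, mulVecLin_apply, mulVec_mulVec, (hθ x).sub_mul_add,
      one_mulVec]
    exact fun i hi => Pi.single_eq_of_ne (fun h => hi (by rwa [h])) _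
  have hθL : ∀ x i j, θ x i j ≠ 0 → i ∈ L x := by
    intro x i j hij
    by_contra hi
    have hj := (hθ x i j hij).2.1
    have h := (mem_relSpace.mp (hcol x j hj)).1 i hi
    rw [mulVec_single_one, Matrix.col_apply, Matrix.add_apply,
      Matrix.one_apply_ne fun h => hi (by rw [h]; exact hML x hj), zero_add] at h
    exact hij h
  set φ₁ : ∀ x, Fin (k x) → W x := fun x => rowMul (φ x) (1 + θ x) with hφ₁
  have hzero : ∀ x, ∀ j ∈ M x, φ₁ x j = 0 := by
    intro x j hj
    have h := (mem_relSpace.mp (hcol x j hj)).2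
    rwa [mulVec_single_one] at h
  have hsame : ∀ x, ∀ j ∉ M x, φ₁ x j = φ x j := by
    intro x j hj
    rw [hφ₁]
    simp only
    rw [rowMul_one_add, Finset.sum_eq_zero, add_zero]
    intro i _
    by_contra h
    exact hj (hθ x i j (left_ne_zero_of_smul h)).2.1
  have hφ₁0 : φ₁ ≠ 0 := by
    intro h
    apply hφ0
    ext1 x
    rw [← rowMul_one (φ x), ← (hθ x).add_mul_sub, rowMul_mul]
    change rowMul (φ₁ x) _ = _
    rw [h]
    ext j
    simp [rowMul_apply]
  refine ⟨M, hML, ?_, ⟨_, hN, fun _ => rfl⟩, ?_⟩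
  · intro h
    apply hφ₁0
    ext x j
    by_cases hj : j ∈ M x
    · exact hzero x j hj
    · rw [hsame x j hj]
      exact (mem_rowSpace.mp hφ x j).2 (by rwa [← h])
  · intro v' hv'
    obtain ⟨v₂, hv₂, hM₂, hle⟩ := exists_replace_block F L (conj (-θ) v) hv'
    have hker₂ : coupling L v₂ w φ₁ = 0 := by
      have h1 := coupling_conj (v := v) (w := w) hθ hML hθL φ
      rw [hker] at h1
      ext a j
      have h2 : coupling L (conj (-θ) v) w φ₁ a j = 0 := by
        rw [h1]
        simp [rowMul_apply]
      change _ = (0 : W (tgt a))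
      rw [← h2]
      by_cases hj : j ∈ L (src a)
      · rw [coupling_apply_of_mem _ _ _ hj, coupling_apply_of_mem _ _ _ hj, rowMul_apply,
          rowMul_apply]
        congr 1
        refine Finset.sum_congr rfl fun i _ => ?_
        by_cases hi : i ∈ M (tgt a)
        · rw [hzero _ _ hi, smul_zero, smul_zero]
        · rw [hv₂ a i j hi]
      · rw [coupling_apply_of_notMem _ _ _ hj, coupling_apply_of_notMem _ _ _ hj]
    refine hL v₂ (obsSpace_le_range_of_mem_ker hML (fun w' => ?_) hM₂
      (rowMul_mem_rowSpace hF hθ hML hφ) hker₂ hzero fun x => ?_)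
    · exact ((hmax _ _).trans (finrank_range_couplingOn_le_conj hF v w hθ hML hθL)).trans hle
    · refine (linearIndepOn_relSpace (L x) (φ x)).congr fun j hj => ?_
      exact (hsame x j hj.2).symm

end QRep

end Degeneration

section Descent

variable {V A : Type} {src tgt : A → V} {k : V → ℕ}
  {W : V → Type} [∀ x, AddCommGroup (W x)] [∀ x, Module ℂ (W x)]

theorem exists_forall_le_of_bounded {ι : Type*} [Nonempty ι] (f : ι → ℕ) (b : ℕ)
    (h : ∀ i, f i ≤ b) : ∃ i, ∀ j, f j ≤ f i := by
  have hb : BddAbove (Set.range f) := ⟨b, Set.forall_mem_range.mpr h⟩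
  obtain ⟨i, hi⟩ := Nat.sSup_mem (Set.range_nonempty f) hb
  exact ⟨i, fun j => hi ▸ le_csSup hb ⟨j, rfl⟩⟩

namespace QRep

theorem exists_forall_finrank_range_couplingOn_le [Finite V] [Finite A]
    [∀ x, FiniteDimensional ℂ (W x)] (F : ∀ x, Fin (k x) → Submodule ℂ (W x)) :
    ∃ w : ∀ a, W (src a) →ₗ[ℂ] W (tgt a), ∀ L, ∃ v : QRep src tgt k, ∀ (v' : QRep src tgt k) w',
      Module.finrank ℂ (LinearMap.range (couplingOn F L v' w')) ≤
        Module.finrank ℂ (LinearMap.range (couplingOn F L v w)) := by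
  have hmax : ∀ L, ∃ p : QRep src tgt k × (∀ a, W (src a) →ₗ[ℂ] W (tgt a)),
      ∀ q : QRep src tgt k × (∀ a, W (src a) →ₗ[ℂ] W (tgt a)),
      Module.finrank ℂ (LinearMap.range (couplingOn F L q.1 q.2)) ≤
        Module.finrank ℂ (LinearMap.range (couplingOn F L p.1 p.2)) := fun L =>
    exists_forall_le_of_bounded _ (Module.finrank ℂ (rowSpace F L)) fun _ =>
      LinearMap.finrank_range_le _
  choose p hp using hmax
  obtain ⟨w, hw⟩ := IsLineOpen.iInter_nonempty
    (G := fun L => {w | ∃ v : QRep src tgt k,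
      Module.finrank ℂ (LinearMap.range (couplingOn F L (p L).1 (p L).2)) ≤
        Module.finrank ℂ (LinearMap.range (couplingOn F L v w))})
    (fun L w hw w' => by
      obtain ⟨v, hv⟩ := hw
      refine (isLineOpen_le_finrank_range_couplingOn F L _ (v, w) hv (v, w')).subset
        fun t ht ht' => ht ⟨v, ?_⟩
      have h : v + t • (v - v) = v := by rw [sub_self, smul_zero, add_zero]
      simpa [h] using ht')
    fun L => ⟨(p L).2, (p L).1, le_rfl⟩
  refine ⟨w, fun L => ?_⟩
  obtain ⟨v, hv⟩ := Set.mem_iInter.mp hw L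
  exact ⟨v, fun v' w' => (hp L (v', w')).trans hv⟩

variable {F : ∀ x, Fin (k x) → Submodule ℂ (W x)}

/-- If the coupling maps over all indices are never surjective, some representation avoiding the
zeros of `g` has a subrepresentation for which there is a numerical reason for that. -/
theorem exists_hasPos_sum_lt [Fintype V] [Fintype A] [∀ x, FiniteDimensional ℂ (W x)]
    (hF : ∀ x i j, i ≤ j → F x i ≤ F x j) {g : MvPolynomial (QCoord src tgt k) ℂ} (hg0 : g ≠ 0)
    (hg : ∀ r : QRep src tgt k, MvPolynomial.eval r.coord g ≠ 0 →
      ∀ J, r.HasPos J → IsDominant src tgt J)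
    (hns : ∀ (v : QRep src tgt k) w, ¬ obsSpace src tgt W (fun _ => Finset.univ) ≤
      LinearMap.range (couplingOn F (fun _ => Finset.univ) v w)) :
    ∃ r : QRep src tgt k, MvPolynomial.eval r.coord g ≠ 0 ∧ ∃ L, r.HasPos L ∧
      ∑ x, ∑ j ∈ L x, Module.finrank ℂ (F x j) <
        ∑ a, (L (src a)).card * Module.finrank ℂ (W (tgt a)) := by
  classical
  obtain ⟨w, hw⟩ := exists_forall_finrank_range_couplingOn_le (src := src) (tgt := tgt) F
  suffices key : ∀ (N : ℕ) (L : ∀ x, Finset (Fin (k x))), ∑ x, (L x).card = N →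
      IsDominant src tgt L →
      (∀ v, ¬ obsSpace src tgt W L ≤ LinearMap.range (couplingOn F L v w)) →
      ∃ r : QRep src tgt k, MvPolynomial.eval r.coord g ≠ 0 ∧ ∃ L, r.HasPos L ∧
        ∑ x, ∑ j ∈ L x, Module.finrank ℂ (F x j) <
          ∑ a, (L (src a)).card * Module.finrank ℂ (W (tgt a)) from
    key _ _ rfl isDominant_univ fun v => hns v w
  intro N
  induction N using Nat.strong_induction_on with
  | _ N ih =>
    intro L hLN hL hLns
    obtain ⟨θ, hθ, v₁, hv₁, hgv₁⟩ : ∃ θ, (∀ x, IsShear (L x) (θ x)) ∧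
        ∃ v ∈ blockTri src tgt L, MvPolynomial.eval (conj θ v).coord g ≠ 0 := by
      by_contra! h
      refine hg0 (hL g fun r hr => ?_)
      obtain ⟨θ, hθ, v, hv, rfl⟩ := hasPos_iff.mp hr
      exact h θ hθ v hv
    obtain ⟨v₂, hv₂⟩ := hw L
    let v₃ : QRep src tgt k := fun a i j => if i ∈ L (tgt a) then v₂ a i j else 0
    have hv₃ : v₃ ∈ blockTri src tgt L := fun a i j hi _ => if_neg hi
    have hv₃₂ : couplingOn F L v₃ w = couplingOn F L v₂ w :=
      couplingOn_congr w fun a i j hi _ => if_pos hi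
    obtain ⟨v, hvmax, hvg⟩ := ((isLineOpen_le_finrank_range_couplingOn_left F L w
      (Module.finrank ℂ (LinearMap.range (couplingOn F L v₂ w)))).preimage
        (fun v : blockTri src tgt L => v.1) fun _ _ _ => rfl).inter_nonempty
      ((IsLineOpen.eval_ne_zero g).preimage
        (fun v : blockTri src tgt L => (conj θ v.1).coord) fun v v' t => by
          simp only [Submodule.coe_add, Submodule.coe_smul, Submodule.coe_sub, map_add, map_smul,
            map_sub]
          rfl)
      ⟨⟨v₃, hv₃⟩, by rw [Set.mem_preimage, Set.mem_ofPred_eq, hv₃₂]⟩ ⟨⟨v₁, hv₁⟩, hgv₁⟩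
    replace hvmax := fun (v' : QRep src tgt k) w' => (hv₂ v' w').trans hvmax
    by_cases hinj : Function.Injective (couplingOn F L v.1 w)
    · refine ⟨_, hvg, L, (hasPos_of_mem_blockTri v.2).conj hθ, ?_⟩
      rw [← finrank_rowSpace, ← finrank_obsSpace, ← LinearMap.finrank_range_of_inj hinj]
      exact lt_of_not_ge fun h => hLns v.1 (obsSpace_le_range_iff.mpr h)
    · rw [← LinearMap.ker_eq_bot, ← ne_eq, Submodule.ne_bot_iff] at hinj
      obtain ⟨φ, hφ, hφ0⟩ := hinj
      obtain ⟨M, hML, hne, hM, hMns⟩ := exists_smaller_position hF v.2 hvmax hLns φ.2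
        (fun h => hφ0 (Subtype.ext h)) hφ
      refine ih _ ?_ M rfl (hg _ hvg M (hM.conj hθ)) hMns
      rw [← hLN]
      obtain ⟨x, hx⟩ := Function.ne_iff.mp hne
      exact Finset.sum_lt_sum (fun x _ => Finset.card_le_card (hML x))
        ⟨x, Finset.mem_univ x, Finset.card_lt_card ((hML x).ssubset_of_ne hx)⟩

end QRep

end Descent

section Commutator

variable {m : ℕ}

theorem finrank_inf_ker_add_finrank_map {E E' : Type*} [AddCommGroup E] [Module ℂ E]
    [AddCommGroup E'] [Module ℂ E'] [FiniteDimensional ℂ E] (f : E →ₗ[ℂ] E') (X : Submodule ℂ E) :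
    Module.finrank ℂ (X ⊓ LinearMap.ker f : Submodule ℂ E) + Module.finrank ℂ (X.map f) =
      Module.finrank ℂ X := by
  rw [← LinearMap.finrank_range_add_finrank_ker (f.domRestrict X), LinearMap.range_domRestrict,
    LinearMap.ker_domRestrict, add_comm, ← Submodule.map_comap_subtype,
    Submodule.finrank_map_subtype_eq]

theorem disjoint_coordSubspace_map {L : Finset (Fin m)} {θ : Matrix (Fin m) (Fin m) ℂ}
    (h : IsShear L θ) (X : Submodule ℂ (Fin m → ℂ)) :
    coordSubspace L ⊓ X.map θ.mulVecLin = ⊥ := by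
  rw [eq_bot_iff]
  rintro _ ⟨h1, u, -, rfl⟩
  rw [Submodule.mem_bot]
  ext i
  by_cases hi : i ∈ L
  · rw [mulVecLin_apply, mulVec, dotProduct]
    refine Finset.sum_eq_zero fun j _ => ?_
    by_contra hne
    exact (h i j (left_ne_zero_of_mul hne)).1 hi
  · exact h1 i hi

theorem finrank_inf_ker_add_finrank_sup_map {L : Finset (Fin m)}
    {θ : Matrix (Fin m) (Fin m) ℂ} (h : IsShear L θ) {X : Submodule ℂ (Fin m → ℂ)}
    (hX : X ≤ coordSubspace L) :
    Module.finrank ℂ (X ⊓ LinearMap.ker θ.mulVecLin : Submodule ℂ (Fin m → ℂ)) +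
      Module.finrank ℂ (X ⊔ X.map θ.mulVecLin : Submodule ℂ (Fin m → ℂ)) =
      2 * Module.finrank ℂ X := by
  have h1 := finrank_inf_ker_add_finrank_map θ.mulVecLin X
  have h2 := Submodule.finrank_sup_add_finrank_inf_eq X (X.map θ.mulVecLin)
  rw [eq_bot_iff.mpr ((inf_le_inf_right _ hX).trans (disjoint_coordSubspace_map h X).le),
    finrank_bot] at h2
  omega

theorem card_leadingIndices_shear {L : Finset (Fin m)} {θ : Matrix (Fin m) (Fin m) ℂ}
    (h : IsShear L θ) :
    (leadingIndices (coordSubspace L ⊓ LinearMap.ker θ.mulVecLin)).card +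
      (leadingIndices (coordSubspace L ⊔ (coordSubspace L).map θ.mulVecLin)).card =
      2 * L.card := by
  rw [← finrank_eq_card_leadingIndices, ← finrank_eq_card_leadingIndices,
    finrank_inf_ker_add_finrank_sup_map h le_rfl, finrank_coordSubspace]

theorem card_filter_leadingIndices_shear {L : Finset (Fin m)} {θ : Matrix (Fin m) (Fin m) ℂ}
    (h : IsShear L θ) (t : ℕ) :
    2 * (L.filter fun i : Fin m => (i : ℕ) < t).card ≤
      ((leadingIndices (coordSubspace L ⊓ LinearMap.ker θ.mulVecLin)).filter
        fun i : Fin m => (i : ℕ) < t).card +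
      ((leadingIndices (coordSubspace L ⊔ (coordSubspace L).map θ.mulVecLin)).filter
        fun i : Fin m => (i : ℕ) < t).card := by
  conv_lhs => rw [← leadingIndices_coordSubspace L]
  rw [← finrank_inf_stdFlag, ← finrank_inf_stdFlag, ← finrank_inf_stdFlag,
    ← finrank_inf_ker_add_finrank_sup_map h inf_le_left, inf_right_comm]
  refine Nat.add_le_add_left (Submodule.finrank_mono (sup_le ?_ ?_)) _
  · exact inf_le_inf_right _ le_sup_left
  · refine le_inf ((Submodule.map_mono inf_le_left).trans le_sup_right) ?_
    rintro _ ⟨u, hu, rfl⟩ i hi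
    rw [mulVecLin_apply, mulVec, dotProduct]
    refine Finset.sum_eq_zero fun j _ => ?_
    by_contra hne
    exact right_ne_zero_of_mul hne
      (hu.2 j (hi.trans (h i j (left_ne_zero_of_mul hne)).2.2.le))

theorem eq_zero_of_leadingIndices_subset {L : Finset (Fin m)} {θ : Matrix (Fin m) (Fin m) ℂ}
    (h : IsShear L θ)
    (hL : (leadingIndices (coordSubspace L ⊔ (coordSubspace L).map θ.mulVecLin)).card ≤ L.card) :
    θ = 0 := by
  have h1 : coordSubspace L = coordSubspace L ⊔ (coordSubspace L).map θ.mulVecLin := by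
    refine Submodule.eq_of_le_of_finrank_le le_sup_left ?_
    rwa [finrank_coordSubspace, finrank_eq_card_leadingIndices]
  have h2 : (coordSubspace L).map θ.mulVecLin = ⊥ := by
    rw [← disjoint_coordSubspace_map h (coordSubspace L), eq_comm, inf_eq_right]
    exact sup_eq_left.mp h1.symm
  ext i j
  by_contra hne
  have hj := (h i j hne).2.1
  have h3 : θ.mulVecLin (Pi.single j 1) ∈ (coordSubspace L).map θ.mulVecLin :=
    ⟨_, fun i hi => Pi.single_eq_of_ne (fun h => hi (by rwa [h])) _, rfl⟩
  rw [h2, Submodule.mem_bot, mulVecLin_apply, mulVec_single_one] at h3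
  exact hne (congr_fun h3 i)

theorem sum_mul_le_of_partial_sums_nonneg : ∀ {m : ℕ} (δ c : Fin m → ℤ), Monotone c →
    (∀ t : ℕ, 0 ≤ ∑ j with (j : Fin m).val < t, δ j) → ∀ C, (∀ j, c j ≤ C) →
    ∑ j, δ j * c j ≤ C * ∑ j, δ j
  | 0, _, _, _, _, _, _ => by simp
  | m + 1, δ, c, hc, hδ, C, hC => by
    have h1 := sum_mul_le_of_partial_sums_nonneg (fun j : Fin m => δ j.castSucc)
      (fun j => c j.castSucc) (fun i j hij => hc (by simpa using hij)) (fun t => by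
        have := hδ (min t m)
        rw [Finset.sum_filter, Fin.sum_univ_castSucc] at this
        rw [Finset.sum_filter]
        simpa using this) (c (Fin.last m)) fun j => hc (Fin.le_last _)
    have h2 : 0 ≤ ∑ j, δ j := by
      have := hδ (m + 1)
      rwa [Finset.filter_true_of_mem fun j _ => j.is_lt] at this
    calc ∑ j, δ j * c j ≤ c (Fin.last m) * ∑ j, δ j := by
          rw [Fin.sum_univ_castSucc, Fin.sum_univ_castSucc, mul_add, mul_comm (δ _)]
          exact add_le_add_left h1 _
      _ ≤ C * ∑ j, δ j := mul_le_mul_of_nonneg_right (hC _) h2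

theorem sum_add_sum_le_of_card_filter_le {L M P : Finset (Fin m)}
    (hcard : M.card + P.card = 2 * L.card)
    (hle : ∀ t : ℕ, 2 * (L.filter fun i : Fin m => (i : ℕ) < t).card ≤
      (M.filter fun i : Fin m => (i : ℕ) < t).card + (P.filter fun i : Fin m => (i : ℕ) < t).card)
    {c : Fin m → ℤ} (hc : Monotone c) :
    ∑ j ∈ M, c j + ∑ j ∈ P, c j ≤ 2 * ∑ j ∈ L, c j := by
  classical
  let ind : Finset (Fin m) → Fin m → ℤ := fun S j => if j ∈ S then 1 else 0
  have hind : ∀ S D : Finset (Fin m), ∑ j ∈ D, ind S j = ((S ∩ D).card : ℤ) := fun S D => by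
    simp [ind, Finset.inter_comm]
  have hsum : ∀ S : Finset (Fin m), ∑ j, ind S j * c j = ∑ j ∈ S, c j := fun S => by
    simp [ind]
  rcases isEmpty_or_nonempty (Fin m) with h | h
  · simp [Finset.eq_empty_of_isEmpty]
  have key := sum_mul_le_of_partial_sums_nonneg (fun j => ind M j + ind P j - 2 * ind L j) c hc
    (fun t => by
      rw [Finset.sum_sub_distrib, Finset.sum_add_distrib, ← Finset.mul_sum, hind, hind, hind,
        Finset.inter_filter, Finset.inter_filter, Finset.inter_filter, Finset.inter_univ,
        Finset.inter_univ, Finset.inter_univ]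
      have := hle t
      omega) (Finset.univ.sup' Finset.univ_nonempty c) fun j => Finset.le_sup' c (Finset.mem_univ j)
  rw [Finset.sum_sub_distrib (s := Finset.univ), Finset.sum_add_distrib, ← Finset.mul_sum, hind,
    hind, hind, Finset.inter_univ, Finset.inter_univ, Finset.inter_univ] at key
  simp only [sub_mul, add_mul, mul_assoc, Finset.sum_sub_distrib, Finset.sum_add_distrib,
    ← Finset.mul_sum, hsum] at key
  have : (M.card : ℤ) + P.card - 2 * L.card = 0 := by omega
  rw [this, mul_zero] at key
  linarith

end Commutator

section Extremal

variable {V A : Type} {src tgt : A → V} {k : V → ℕ}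

/-- The slope-type functional on positions. -/
def chi [Fintype V] [Fintype A] (src : A → V) (c : ∀ x, Fin (k x) → ℤ) (d : A → ℤ)
    (L : ∀ x, Finset (Fin (k x))) : ℤ :=
  ∑ x, ∑ j ∈ L x, c x j - ∑ a, ((L (src a)).card : ℤ) * d a

namespace QRep

theorem stable_inf_ker {L : ∀ x, Finset (Fin (k x))} {v : QRep src tgt k}
    (hv : v ∈ blockTri src tgt L) {θ : ∀ x, Matrix (Fin (k x)) (Fin (k x)) ℂ}
    (hθ : ∀ x, IsShear (L x) (θ x))
    (hcomm : (fun a => θ (tgt a) * v a - v a * θ (src a)) ∈ blockTri src tgt L) :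
    v.Stable fun x => coordSubspace (L x) ⊓ LinearMap.ker (θ x).mulVecLin := by
  intro a u hu
  have h1 := stable_coordSubspace_iff.mpr hv a u hu.1
  refine ⟨h1, ?_⟩
  have h2 := stable_coordSubspace_iff.mpr hcomm a u hu.1
  have hu2 : θ (src a) *ᵥ u = 0 := hu.2
  rw [sub_mulVec, ← mulVec_mulVec, ← mulVec_mulVec, hu2, mulVec_zero, sub_zero] at h2
  have h3 : (θ (tgt a)).mulVecLin (v a *ᵥ u) ∈
      coordSubspace (L (tgt a)) ⊓ (⊤ : Submodule ℂ _).map (θ (tgt a)).mulVecLin :=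
    ⟨h2, _, trivial, rfl⟩
  rw [disjoint_coordSubspace_map (hθ _)] at h3
  exact h3

theorem stable_sup_map {L : ∀ x, Finset (Fin (k x))} {v : QRep src tgt k}
    (hv : v ∈ blockTri src tgt L) {θ : ∀ x, Matrix (Fin (k x)) (Fin (k x)) ℂ}
    (hcomm : (fun a => θ (tgt a) * v a - v a * θ (src a)) ∈ blockTri src tgt L) :
    v.Stable fun x => coordSubspace (L x) ⊔ (coordSubspace (L x)).map (θ x).mulVecLin := by
  intro a u hu
  obtain ⟨u₁, hu₁, _, ⟨u₂, hu₂, rfl⟩, rfl⟩ := Submodule.mem_sup.mp hu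
  have h1 := stable_coordSubspace_iff.mpr hv
  have h2 := stable_coordSubspace_iff.mpr hcomm a u₂ hu₂
  have h3 : v a *ᵥ (u₁ + (θ (src a)).mulVecLin u₂) =
      (v a *ᵥ u₁ - (θ (tgt a) * v a - v a * θ (src a)) *ᵥ u₂) +
        (θ (tgt a)).mulVecLin (v a *ᵥ u₂) := by
    rw [mulVecLin_apply, mulVecLin_apply, mulVec_add, sub_mulVec, mulVec_mulVec, mulVec_mulVec]
    abel
  rw [h3]
  exact Submodule.add_mem_sup (sub_mem (h1 a u₁ hu₁) h2) ⟨_, h1 a u₂ hu₂, rfl⟩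

theorem sum_card_shearPairs_le [Fintype V] [Fintype A] {L : ∀ x, Finset (Fin (k x))}
    (v : QRep src tgt k)
    (h : ∀ θ : ∀ x, Matrix (Fin (k x)) (Fin (k x)) ℂ, (∀ x, IsShear (L x) (θ x)) →
      (fun a => θ (tgt a) * v a - v a * θ (src a)) ∈ blockTri src tgt L → θ = 0) :
    ∑ x, ((shearPairs (L x)).card : ℤ) ≤
      ∑ a, ((L (src a)).card : ℤ) * ((k (tgt a) : ℤ) - (L (tgt a)).card) := by
  classical
  let e : (∀ x, shearPairs (L x) → ℂ) →ₗ[ℂ] ∀ x, Matrix (Fin (k x)) (Fin (k x)) ℂ :=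
    { toFun := fun p x => Matrix.of fun i j =>
        if h : (i, j) ∈ shearPairs (L x) then p x ⟨_, h⟩ else 0
      map_add' := fun p q => by
        ext x i j
        simp only [Pi.add_apply, Matrix.add_apply, Matrix.of_apply]
        split_ifs <;> simp
      map_smul' := fun c p => by
        ext x i j
        simp only [Pi.smul_apply, Matrix.smul_apply, Matrix.of_apply, RingHom.id_apply]
        split_ifs <;> simp }
  let f : (∀ x, Matrix (Fin (k x)) (Fin (k x)) ℂ) →ₗ[ℂ]
      ∀ a, {i // i ∉ L (tgt a)} × {j // j ∈ L (src a)} → ℂ :=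
    { toFun := fun θ a p => (θ (tgt a) * v a - v a * θ (src a)) p.1 p.2
      map_add' := fun p q => by
        ext a i
        simp only [Pi.add_apply, Matrix.add_mul, Matrix.mul_add, Matrix.sub_apply,
          Matrix.add_apply]
        ring
      map_smul' := fun c p => by
        ext a i
        simp only [Pi.smul_apply, Matrix.smul_mul, Matrix.mul_smul, Matrix.sub_apply,
          Matrix.smul_apply, RingHom.id_apply, smul_sub] }
  have hinj : Function.Injective (f ∘ₗ e) := by
    rw [← LinearMap.ker_eq_bot, LinearMap.ker_eq_bot']
    intro p hp
    have h0 := h (e p) (fun x i j hij => by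
      by_contra hn
      exact hij (dif_neg (by rwa [mem_shearPairs]))) (fun a i j hi hj =>
        congr_fun (congr_fun hp a) (⟨i, hi⟩, ⟨j, hj⟩))
    ext x ⟨⟨i, j⟩, hij⟩
    have h1 : e p x i j = 0 := by rw [h0]; rfl
    exact (dif_pos hij).symm.trans h1
  have h2 := LinearMap.finrank_le_finrank_of_injective hinj
  rw [Module.finrank_pi_fintype, Module.finrank_pi_fintype] at h2
  simp only [Module.finrank_fintype_fun_eq_card, Fintype.card_prod, Fintype.card_coe,
    Fintype.card_subtype_compl, Fintype.card_fin] at h2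
  have h3 : ∀ a, ((L (src a)).card : ℤ) * ((k (tgt a) : ℤ) - (L (tgt a)).card) =
      (((k (tgt a) - (L (tgt a)).card) * (L (src a)).card : ℕ) : ℤ) := fun a => by
    have := card_finset_fin_le (L (tgt a))
    push_cast [Nat.cast_sub this]
    ring
  simp_rw [h3]
  exact_mod_cast h2

/-- A subrepresentation that is extremal for `chi` satisfies a dimension estimate. -/
theorem HasPos.exists_extremal [Fintype V] [Fintype A] {r : QRep src tgt k}
    {c : ∀ x, Fin (k x) → ℤ} (hc : ∀ x, Monotone (c x)) (d : A → ℤ)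
    {L₀ : ∀ x, Finset (Fin (k x))} (hL₀ : r.HasPos L₀) :
    ∃ L, r.HasPos L ∧ chi src c d L ≤ chi src c d L₀ ∧
      ∑ x, ((shearPairs (L x)).card : ℤ) ≤
        ∑ a, ((L (src a)).card : ℤ) * ((k (tgt a) : ℤ) - (L (tgt a)).card) := by
  classical
  obtain ⟨L, hL, hmin⟩ := Finset.exists_min_image
    (Finset.univ.filter fun L : ∀ x, Finset (Fin (k x)) => r.HasPos L)
    (fun L => toLex (chi src c d L, -∑ x, ((L x).card : ℤ))) ⟨L₀, by simpa using hL₀⟩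
  simp only [Finset.mem_filter, Finset.mem_univ, true_and, Prod.Lex.toLex_le_toLex] at hL hmin
  have hle : ∀ M, r.HasPos M → chi src c d L ≤ chi src c d M := fun M hM =>
    (hmin M hM).elim (fun h => h.le) fun h => h.1.le
  refine ⟨L, hL, hle L₀ hL₀, ?_⟩
  obtain ⟨θ₀, hθ₀, v, hv, rfl⟩ := hasPos_iff.mp hL
  refine sum_card_shearPairs_le v fun θ hθ hcomm => ?_
  set N₁ := fun x => coordSubspace (L x) ⊓ LinearMap.ker (θ x).mulVecLin
  set N₂ := fun x => coordSubspace (L x) ⊔ (coordSubspace (L x)).map (θ x).mulVecLin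
  have h1 : (QRep.conj θ₀ v).HasPos fun x => leadingIndices (N₁ x) :=
    HasPos.conj hθ₀ ⟨N₁, stable_inf_ker hv hθ hcomm, fun _ => rfl⟩
  have h2 : (QRep.conj θ₀ v).HasPos fun x => leadingIndices (N₂ x) :=
    HasPos.conj hθ₀ ⟨N₂, stable_sup_map hv hcomm, fun _ => rfl⟩
  have hcard : ∀ x, (leadingIndices (N₁ x)).card + (leadingIndices (N₂ x)).card =
      2 * (L x).card := fun x => card_leadingIndices_shear (hθ x)
  have hchi : chi src c d (fun x => leadingIndices (N₁ x)) +
      chi src c d (fun x => leadingIndices (N₂ x)) ≤ 2 * chi src c d L := by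
    have hA : ∑ x, ∑ j ∈ leadingIndices (N₁ x), c x j + ∑ x, ∑ j ∈ leadingIndices (N₂ x), c x j ≤
        2 * ∑ x, ∑ j ∈ L x, c x j := by
      rw [← Finset.sum_add_distrib, Finset.mul_sum]
      exact Finset.sum_le_sum fun x _ => sum_add_sum_le_of_card_filter_le (hcard x)
        (card_filter_leadingIndices_shear (hθ x)) (hc x)
    have hB : ∑ a, ((leadingIndices (N₁ (src a))).card : ℤ) * d a +
        ∑ a, ((leadingIndices (N₂ (src a))).card : ℤ) * d a =
        2 * ∑ a, ((L (src a)).card : ℤ) * d a := by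
      rw [← Finset.sum_add_distrib, Finset.mul_sum]
      refine Finset.sum_congr rfl fun a _ => ?_
      rw [← add_mul, ← mul_assoc]
      congr 1
      exact_mod_cast hcard (src a)
    simp only [chi]
    linarith
  have h3 : ∑ x, ((leadingIndices (N₂ x)).card : ℤ) ≤ ∑ x, ((L x).card : ℤ) := by
    rcases hmin _ h2 with h | h
    · have := hle _ h1
      linarith
    · linarith [h.2]
  ext1 x
  refine eq_zero_of_leadingIndices_subset (hθ x) ?_
  by_contra! hlt
  have hge : ∀ y, (L y).card ≤ (leadingIndices (N₂ y)).card := fun y => by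
    rw [← finrank_coordSubspace, ← finrank_eq_card_leadingIndices]
    exact Submodule.finrank_mono le_sup_left
  have h4 : ∑ x, (L x).card < ∑ x, (leadingIndices (N₂ x)).card :=
    Finset.sum_lt_sum (fun y _ => hge y) ⟨x, Finset.mem_univ x, hlt⟩
  exact absurd h3 (by exact_mod_cast not_le.mpr h4)

end QRep

end Extremal

section Positions

variable {m : ℕ}

theorem sum_orderEmbOfFin {M : Type*} [AddCommMonoid M] (J : Finset (Fin m)) (f : Fin m → M) :
    ∑ i, f (J.orderEmbOfFin rfl i) = ∑ j ∈ J, f j := by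
  conv_rhs => rw [← Finset.map_orderEmbOfFin_univ J rfl, Finset.sum_map]
  rfl

theorem exists_orderEmbOfFin_eq {J : Finset (Fin m)} {j : Fin m} (hj : j ∈ J) :
    ∃ i, J.orderEmbOfFin rfl i = j := by
  have h : j ∈ Set.range (J.orderEmbOfFin rfl) := by rwa [Finset.range_orderEmbOfFin]
  exact h

theorem card_filter_lt_orderEmbOfFin (J : Finset (Fin m)) (j : Fin J.card) :
    (J.filter fun i => i < J.orderEmbOfFin rfl j).card = j := by
  rw [Finset.card_filter, ← sum_orderEmbOfFin J fun i => if i < J.orderEmbOfFin rfl j then 1 else 0]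
  simp only [OrderEmbedding.lt_iff_lt, ← Finset.card_filter, Finset.filter_gt_eq_Iio, Fin.card_Iio]

theorem card_gaps_add (J : Finset (Fin m)) (j : Fin J.card) :
    (Finset.univ.filter fun i => i ∉ J ∧ i < J.orderEmbOfFin rfl j).card + j =
      J.orderEmbOfFin rfl j := by
  conv_lhs => rw [← card_filter_lt_orderEmbOfFin J j]
  rw [add_comm, ← Finset.card_union_of_disjoint]
  · rw [← Fin.card_Iio (J.orderEmbOfFin rfl j)]
    congr 1
    ext i
    simp only [Finset.mem_union, Finset.mem_filter, Finset.mem_univ, true_and, Finset.mem_Iio]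
    tauto
  · rw [Finset.disjoint_left]
    intro i hi hi'
    exact (Finset.mem_filter.mp hi').2.1 (Finset.mem_filter.mp hi).1

theorem card_shearPairs (J : Finset (Fin m)) :
    ((shearPairs J).card : ℤ) =
      ∑ j : Fin J.card, (((J.orderEmbOfFin rfl j : ℕ) : ℤ) - ((j : ℕ) : ℤ)) := by
  have h1 : ∀ j : Fin J.card, ((J.orderEmbOfFin rfl j : ℕ) : ℤ) - ((j : ℕ) : ℤ) =
      ((Finset.univ.filter fun i => i ∉ J ∧ i < J.orderEmbOfFin rfl j).card : ℤ) := by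
    intro j
    have := card_gaps_add J j
    omega
  simp only [h1]
  rw [sum_orderEmbOfFin J fun j => ((Finset.univ.filter fun i => i ∉ J ∧ i < j).card : ℤ),
    ← Nat.cast_sum]
  congr 1
  rw [Finset.card_eq_sum_card_fiberwise (f := Prod.snd) (t := J)]
  · refine Finset.sum_congr rfl fun j hj => ?_
    refine Finset.card_bij (fun p _ => p.1) ?_ ?_ ?_
    · intro p hp
      rw [Finset.mem_filter, mem_shearPairs] at hp
      simpa [← hp.2] using And.intro hp.1.1 hp.1.2.2
    · intro p hp q hq hpq
      exact Prod.ext hpq ((Finset.mem_filter.mp hp).2.trans (Finset.mem_filter.mp hq).2.symm)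
    · intro i hi
      rw [Finset.mem_filter] at hi
      exact ⟨(i, j), by simp [mem_shearPairs, hi.2, hj], rfl⟩
  · intro p hp
    exact (mem_shearPairs.mp hp).2.1

/-- The vectors on the complement of `J` supported on the indices below a bound. -/
def gapSpace (J : Finset (Fin m)) (b : Fin m) : Submodule ℂ ({i // i ∉ J} → ℂ) :=
  Submodule.pi Set.univ fun i => if (i : Fin m) < b then ⊤ else ⊥

theorem mem_gapSpace {J : Finset (Fin m)} {b : Fin m} {f : {i // i ∉ J} → ℂ} :
    f ∈ gapSpace J b ↔ ∀ i, f i ≠ 0 → (i : Fin m) < b := by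
  simp only [gapSpace, Submodule.mem_pi, Set.mem_univ, true_implies]
  refine forall_congr' fun i => ?_
  split_ifs with h <;> simp [h]

theorem finrank_gapSpace_add (J : Finset (Fin m)) (j : Fin J.card) :
    Module.finrank ℂ (gapSpace J (J.orderEmbOfFin rfl j)) + j = J.orderEmbOfFin rfl j := by
  conv_rhs => rw [← card_gaps_add J j]
  rw [gapSpace, QRep.finrank_submodule_pi]
  congr 1
  have h1 : ∀ i : {i // i ∉ J}, Module.finrank ℂ
      (if (i : Fin m) < J.orderEmbOfFin rfl j then ⊤ else ⊥ : Submodule ℂ ℂ) =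
      if (i : Fin m) < J.orderEmbOfFin rfl j then 1 else 0 := by
    intro i
    by_cases h : (i : Fin m) < J.orderEmbOfFin rfl j
    · rw [if_pos h, if_pos h, finrank_top, Module.finrank_self]
    · rw [if_neg h, if_neg h, finrank_bot]
  rw [Finset.sum_congr rfl fun i _ => h1 i, ← Finset.filter_filter, Finset.card_filter]
  exact (Finset.sum_subtype _ (by simp)
    fun i => if i < J.orderEmbOfFin rfl j then 1 else 0).symm

end Positions

section Sufficiency

variable {V A : Type} [Fintype V] [Fintype A] {src tgt : A → V} {n : V → ℕ}

namespace QRep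

theorem isDominant_of_obsSpace_le {K : ∀ x, Finset (Fin (n x))}
    {v : QRep src tgt fun x => (K x).card}
    {w : ∀ a, ({i // i ∉ K (src a)} → ℂ) →ₗ[ℂ] ({i // i ∉ K (tgt a)} → ℂ)}
    (h : obsSpace (k := fun x => (K x).card) src tgt (fun x => {i // i ∉ K x} → ℂ)
        (fun _ => Finset.univ) ≤
      LinearMap.range (couplingOn (fun x j => gapSpace (K x) ((K x).orderEmbOfFin rfl j))
        (fun _ => Finset.univ) v w)) : IsDominant src tgt K := by
  classical
  let idx : ∀ x (i : Fin (n x)), i ∈ K x → Fin (K x).card := fun x i hi =>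
    ((K x).orderIsoOfFin rfl).symm ⟨i, hi⟩
  have hidx : ∀ x (p : Fin (K x).card) (hp : (K x).orderEmbOfFin rfl p ∈ K x),
      idx x ((K x).orderEmbOfFin rfl p) hp = p := fun x p hp => by
    simp only [idx, OrderIso.symm_apply_eq]
    rfl
  let u : QRep src tgt n := fun a i j =>
    if hi : i ∈ K (tgt a) then
      if hj : j ∈ K (src a) then v a (idx _ i hi) (idx _ j hj) else 0
    else if hj : j ∈ K (src a) then 0 else w a (Pi.single ⟨j, hj⟩ 1) ⟨i, hi⟩
  have hu : u ∈ blockTri src tgt K := by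
    intro a i j hi hj
    simp only [u, dif_neg hi, dif_pos hj]
  refine isDominant_of_surjective hu fun T => ?_
  obtain ⟨ψ, hψ, hψT⟩ := exists_mem_rowSpace_of_obsSpace_le h
    fun a q i => T a i ((K (src a)).orderEmbOfFin rfl q)
  rw [mem_rowSpace] at hψ
  let θ : ∀ x, Matrix (Fin (n x)) (Fin (n x)) ℂ := fun x i j =>
    if hij : i ∉ K x ∧ j ∈ K x then ψ x (idx x j hij.2) ⟨i, hij.1⟩ else 0
  refine ⟨θ, fun x i j hij => ?_, fun a i j hi hj => ?_⟩
  · simp only [θ] at hij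
    split_ifs at hij with h1
    · obtain ⟨q, rfl⟩ := exists_orderEmbOfFin_eq h1.2
      rw [hidx] at hij
      exact ⟨h1.1, h1.2, mem_gapSpace.mp ((hψ x q).1 (Finset.mem_univ _)) _ hij⟩
    · exact absurd rfl hij
  · obtain ⟨q, rfl⟩ := exists_orderEmbOfFin_eq hj
    have hT := congrFun (hψT a q (Finset.mem_univ _)) ⟨i, hi⟩
    simp only [Pi.sub_apply] at hT
    rw [← hT, Matrix.sub_apply, Matrix.mul_apply, Matrix.mul_apply]
    congr 1
    · rw [rowMul_apply, Finset.sum_apply]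
      rw [← Finset.sum_subset (Finset.subset_univ (K (tgt a))), ← sum_orderEmbOfFin]
      · refine Finset.sum_congr rfl fun p _ => ?_
        have hp := (K (tgt a)).orderEmbOfFin_mem rfl p
        simp only [θ, u, dif_pos hp, dif_pos hj, dif_pos (And.intro hi hp), hidx, Pi.smul_apply,
          smul_eq_mul, mul_comm]
      · intro l _ hl
        simp [θ, hl]
    · rw [LinearMap.pi_apply_eq_sum_univ (w a), Finset.sum_apply]
      rw [← Finset.sum_subset (Finset.subset_univ (Finset.univ.filter fun l => l ∉ K (src a)))]
      · rw [Finset.sum_subtype (p := fun l => l ∉ K (src a)) _ (by simp)]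
        refine Finset.sum_congr rfl fun l _ => ?_
        have hl : (fun l' => if l = l' then (1 : ℂ) else 0) = Pi.single l 1 := by
          ext l'
          simp [Pi.single_apply, eq_comm]
        simp only [θ, u, dif_neg hi, dif_neg l.2, dif_pos (And.intro l.2 hj), hidx, Pi.smul_apply,
          smul_eq_mul, mul_comm, hl]
      · intro l _ hl
        simp only [Finset.mem_filter, Finset.mem_univ, true_and, not_not] at hl
        simp [θ, hl]

theorem isQIntersecting_of_forall_le {K : ∀ x, Finset (Fin (n x))}
    (h : ∀ L : ∀ x, Finset (Fin (K x).card),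
      IsQIntersecting src tgt (fun x => (K x).card) L →
      (∑ a, ((L (src a)).card : ℤ) * ((n (tgt a) : ℤ) - ((L (tgt a)).card : ℤ))) ≤
        ∑ x, ∑ j : Fin (L x).card,
          ((((K x).orderEmbOfFin rfl ((L x).orderEmbOfFin rfl j) : ℕ) : ℤ) - ((j : ℕ) : ℤ))) :
    IsQIntersecting src tgt n K := by
  by_contra hK
  replace hK : ¬ IsDominant src tgt K := fun hd => hK hd.isQIntersecting
  obtain ⟨g, hg0, hg⟩ := exists_forall_hasPos_isDominant (src := src) (tgt := tgt)
    (n := fun x => (K x).card)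
  let e := fun x => (K x).orderEmbOfFin rfl
  obtain ⟨r, hr, L₀, hL₀, hlt⟩ := exists_hasPos_sum_lt (W := fun x => {i // i ∉ K x} → ℂ)
    (F := fun x j => gapSpace (K x) (e x j)) (fun x i j hij f hf => mem_gapSpace.mpr fun l hl =>
      (mem_gapSpace.mp hf l hl).trans_le ((e x).monotone hij)) hg0 hg
    fun v w hle => hK (isDominant_of_obsSpace_le hle)
  let c : ∀ x, Fin (K x).card → ℤ := fun x j => ((e x j : ℕ) : ℤ) - ((j : ℕ) : ℤ)
  have hcF : ∀ x j, (Module.finrank ℂ (gapSpace (K x) (e x j)) : ℤ) = c x j := by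
    intro x j
    have := finrank_gapSpace_add (K x) j
    simp only [c, e]
    omega
  have hc : ∀ x, Monotone (c x) := by
    intro x i j hij
    rw [← hcF, ← hcF, Nat.cast_le]
    exact Submodule.finrank_mono fun f hf => mem_gapSpace.mpr fun l hl =>
      (mem_gapSpace.mp hf l hl).trans_le ((e x).monotone hij)
  have hW : ∀ x, (Module.finrank ℂ ({i // i ∉ K x} → ℂ) : ℤ) = (n x : ℤ) - (K x).card := by
    intro x
    have h1 := Fintype.card_subtype_compl fun i => i ∈ K x
    have h2 := Finset.card_le_univ (K x)
    rw [Fintype.card_fin] at h1 h2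
    rw [Module.finrank_fintype_fun_eq_card, h1, Fintype.card_coe, Nat.cast_sub h2]
  obtain ⟨L, hL, hχ, hshear⟩ := hL₀.exists_extremal hc
    fun a => (n (tgt a) : ℤ) - (K (tgt a)).card
  have h1 := h L (hg r hr L hL).isQIntersecting
  have h2 : (∑ x, ∑ j : Fin (L x).card,
      ((((K x).orderEmbOfFin rfl ((L x).orderEmbOfFin rfl j) : ℕ) : ℤ) - ((j : ℕ) : ℤ))) =
      ∑ x, ∑ j ∈ L x, c x j + ∑ x, ((shearPairs (L x)).card : ℤ) := by
    rw [← Finset.sum_add_distrib]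
    refine Finset.sum_congr rfl fun x _ => ?_
    rw [card_shearPairs, ← sum_orderEmbOfFin (L x) (c x), ← Finset.sum_add_distrib]
    refine Finset.sum_congr rfl fun j _ => ?_
    simp only [c, e]
    ring
  have h3 : (∑ a, ((L (src a)).card : ℤ) * ((n (tgt a) : ℤ) - ((L (tgt a)).card : ℤ))) =
      ∑ a, ((L (src a)).card : ℤ) * ((n (tgt a) : ℤ) - (K (tgt a)).card) +
        ∑ a, ((L (src a)).card : ℤ) * (((K (tgt a)).card : ℤ) - (L (tgt a)).card) := by
    rw [← Finset.sum_add_distrib]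
    exact Finset.sum_congr rfl fun a _ => by ring
  have h4 : chi src c (fun a => (n (tgt a) : ℤ) - (K (tgt a)).card) L₀ < 0 := by
    rw [chi, sub_neg]
    have : ((∑ x, ∑ j ∈ L₀ x, Module.finrank ℂ (gapSpace (K x) (e x j)) : ℕ) : ℤ) <
        ((∑ a, (L₀ (src a)).card * Module.finrank ℂ ({i // i ∉ K (tgt a)} → ℂ) : ℕ) : ℤ) :=
      Nat.cast_lt.mpr hlt
    push_cast at this
    simpa only [hcF, hW] using this
  rw [chi] at hχ
  linarith

end QRep

end Sufficiency

section Necessity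

theorem card_shearPairs_of_card_eq {m k : ℕ} {J : Finset (Fin m)} (h : J.card = k) :
    ((shearPairs J).card : ℤ) =
      ∑ j : Fin k, (((J.orderEmbOfFin h j : ℕ) : ℤ) - ((j : ℕ) : ℤ)) := by
  subst h
  exact card_shearPairs J

theorem orderEmbOfFin_lt_of_le_card {m k t : ℕ} {J : Finset (Fin m)} (h : J.card = k) {j : Fin k}
    (hj : (j : ℕ) + 1 ≤ (J.filter fun i : Fin m => (i : ℕ) < t).card) :
    (J.orderEmbOfFin h j : ℕ) < t := by
  subst h
  by_contra! hlt
  have h1 : (J.filter fun i : Fin m => (i : ℕ) < t) ⊆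
      J.filter fun i => i < J.orderEmbOfFin rfl j :=
    Finset.monotone_filter_right J fun i _ hi => Fin.lt_def.mpr (hi.trans_le hlt)
  have h2 := Finset.card_le_card h1
  rw [card_filter_lt_orderEmbOfFin] at h2
  omega

theorem orderEmbOfFin_map {m k l : ℕ} (e : Fin k ↪o Fin m) {L : Finset (Fin k)} (h : L.card = l)
    (h' : (L.map e.toEmbedding).card = l) (j : Fin l) :
    (L.map e.toEmbedding).orderEmbOfFin h' j = e (L.orderEmbOfFin h j) := by
  refine (congrFun (Finset.orderEmbOfFin_unique (f := fun j => e (L.orderEmbOfFin h j)) h' ?_ ?_)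
    j).symm
  · intro i
    exact Finset.mem_map_of_mem _ (L.orderEmbOfFin_mem h i)
  · exact e.strictMono.comp (L.orderEmbOfFin h).strictMono

theorem leadingIndices_map_extend {m k : ℕ} (e : Fin k ↪o Fin m)
    (T : Submodule ℂ (Fin k → ℂ)) :
    leadingIndices (T.map (Function.ExtendByZero.linearMap ℂ e)) =
      (leadingIndices T).map e.toEmbedding := by
  have happ : ∀ u p, Function.ExtendByZero.linearMap ℂ e u (e p) = u p := fun u p =>
    e.injective.extend_apply _ _ _
  have hnot : ∀ u i, (¬ ∃ p, e p = i) → Function.ExtendByZero.linearMap ℂ e u i = 0 :=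
    fun u i hi => Function.extend_apply' _ _ _ hi
  ext i
  rw [mem_leadingIndices, Finset.mem_map]
  constructor
  · rintro ⟨_, ⟨u, hu, rfl⟩, hi, hlt⟩
    by_cases h : ∃ p, e p = i
    · obtain ⟨p, rfl⟩ := h
      refine ⟨p, mem_leadingIndices.mpr ⟨u, hu, by rwa [happ] at hi, fun p' hp' => ?_⟩, rfl⟩
      rw [← happ u p', hlt _ (e.lt_iff_lt.mpr hp')]
    · exact absurd (hnot u i h) hi
  · rintro ⟨p, hp, rfl⟩
    obtain ⟨u, hu, hup, hlt⟩ := mem_leadingIndices.mp hp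
    refine ⟨_, ⟨u, hu, rfl⟩, ?_, fun i' hi' => ?_⟩
    · change Function.ExtendByZero.linearMap ℂ e u (e p) ≠ 0
      rwa [happ]
    · by_cases h : ∃ p', e p' = i'
      · obtain ⟨p', rfl⟩ := h
        rw [happ, hlt p' (e.lt_iff_lt.mp hi')]
      · exact hnot u i' h

variable {V A : Type} {src tgt : A → V} {n : V → ℕ}

namespace QRep

theorem _root_.IsQIntersecting.exists_hasPos {K : ∀ x, Finset (Fin (n x))}
    (hK : IsQIntersecting src tgt n K) (r : QRep src tgt n) :
    ∃ (J : ∀ x, Finset (Fin (n x))) (hc : ∀ x, (J x).card = (K x).card), r.HasPos J ∧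
      ∀ x j, (J x).orderEmbOfFin (hc x) j ≤ (K x).orderEmbOfFin rfl j := by
  obtain ⟨S, hcard, hpos, hS⟩ := hK fun a => Matrix.mulVecLin (r a)
  refine ⟨fun x => leadingIndices (S x),
    fun x => (finrank_eq_card_leadingIndices _).symm.trans (hcard x),
    ⟨S, fun a u hu => hS a ⟨u, hu, rfl⟩, fun _ => rfl⟩, fun x j => ?_⟩
  have h := hpos x j
  rw [finrank_inf_stdFlag] at h
  exact Fin.le_def.mpr (Nat.lt_succ_iff.mp (orderEmbOfFin_lt_of_le_card _ h))

/-- A position of the subrepresentation on a coordinate subspace is a position of the whole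
representation. -/
theorem HasPos.of_submatrix {k : V → ℕ} {J : ∀ x, Finset (Fin (n x))}
    {e : ∀ x, Fin (k x) ↪o Fin (n x)} (he : ∀ x i, i ∈ J x ↔ ∃ p, e x p = i)
    {v : QRep src tgt n} (hv : v ∈ blockTri src tgt J) {L : ∀ x, Finset (Fin (k x))}
    (h : HasPos (src := src) (tgt := tgt) (n := k)
      (fun a => (v a).submatrix (e (tgt a)) (e (src a))) L) :
    v.HasPos fun x => (L x).map (e x).toEmbedding := by
  classical
  obtain ⟨T, hT, hL⟩ := h
  refine ⟨fun x => (T x).map (Function.ExtendByZero.linearMap ℂ (e x)), ?_, fun x => by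
    rw [leadingIndices_map_extend, hL]⟩
  rintro a _ ⟨u, hu, rfl⟩
  refine ⟨_, hT a u hu, ?_⟩
  have happ : ∀ x u p, Function.ExtendByZero.linearMap ℂ (e x) u (e x p) = u p := fun x u p =>
    (e x).injective.extend_apply _ _ _
  have hnot : ∀ x u i, (¬ ∃ p, e x p = i) → Function.ExtendByZero.linearMap ℂ (e x) u i = 0 :=
    fun x u i hi => Function.extend_apply' _ _ _ hi
  have hsum : ∀ i, (v a *ᵥ Function.ExtendByZero.linearMap ℂ (e (src a)) u) i =
      ∑ p, v a i (e (src a) p) * u p := by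
    intro i
    rw [mulVec, dotProduct]
    rw [← Finset.sum_subset (Finset.subset_univ (Finset.univ.map (e (src a)).toEmbedding)),
      Finset.sum_map]
    · exact Finset.sum_congr rfl fun p _ => congrArg _ (happ _ u p)
    · intro j _ hj
      rw [hnot, mul_zero]
      simpa using hj
  ext i
  rw [hsum]
  by_cases hi : ∃ p, e (tgt a) p = i
  · obtain ⟨p, rfl⟩ := hi
    exact happ _ _ p
  · refine (hnot _ _ i hi).trans (Finset.sum_eq_zero fun p _ => ?_).symm
    rw [hv a i _ (fun h => hi ((he _ i).mp h)) ((he _ _).mpr ⟨p, rfl⟩), zero_mul]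

/-- Positions compose: a position for `L` inside a position for `K`. -/
theorem _root_.IsQIntersecting.exists_hasPos_comp {K : ∀ x, Finset (Fin (n x))}
    (hK : IsQIntersecting src tgt n K) {L : ∀ x, Finset (Fin (K x).card)}
    (hL : IsQIntersecting src tgt (fun x => (K x).card) L) (r : QRep src tgt n) :
    ∃ (J : ∀ x, Finset (Fin (n x))) (hc : ∀ x, (J x).card = (L x).card), r.HasPos J ∧
      ∀ x j, (J x).orderEmbOfFin (hc x) j ≤
        (K x).orderEmbOfFin rfl ((L x).orderEmbOfFin rfl j) := by
  obtain ⟨J, hc, hJ, hJK⟩ := hK.exists_hasPos r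
  obtain ⟨θ, hθ, v, hv, rfl⟩ := hasPos_iff.mp hJ
  obtain ⟨e, he⟩ : ∃ e : ∀ x, Fin (K x).card ↪o Fin (n x),
      e = fun x => (J x).orderEmbOfFin (hc x) := ⟨_, rfl⟩
  have hmem : ∀ x i, i ∈ J x ↔ ∃ p, e x p = i := by
    intro x i
    rw [he, ← Finset.mem_coe, ← Finset.range_orderEmbOfFin (J x) (hc x)]
    rfl
  obtain ⟨M, hcM, hM, hML⟩ := hL.exists_hasPos
    fun a => (v a).submatrix (e (tgt a)) (e (src a))
  refine ⟨fun x => (M x).map (e x).toEmbedding, fun x => by rw [Finset.card_map, hcM],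
    (hM.of_submatrix hmem hv).conj hθ, fun x j => ?_⟩
  rw [orderEmbOfFin_map (e x) (hcM x), he]
  exact (hJK x _).trans (((K x).orderEmbOfFin rfl).monotone (hML x j))

theorem _root_.IsQIntersecting.sum_le [Fintype V] [Fintype A] {K : ∀ x, Finset (Fin (n x))}
    (hK : IsQIntersecting src tgt n K) {L : ∀ x, Finset (Fin (K x).card)}
    (hL : IsQIntersecting src tgt (fun x => (K x).card) L) :
    (∑ a, ((L (src a)).card : ℤ) * ((n (tgt a) : ℤ) - ((L (tgt a)).card : ℤ))) ≤
      ∑ x, ∑ j : Fin (L x).card,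
        ((((K x).orderEmbOfFin rfl ((L x).orderEmbOfFin rfl j) : ℕ) : ℤ) - ((j : ℕ) : ℤ)) := by
  obtain ⟨g, hg0, hg⟩ := exists_forall_hasPos_isDominant (src := src) (tgt := tgt) (n := n)
  obtain ⟨f, hf⟩ : ∃ f, MvPolynomial.eval f g ≠ 0 := by
    by_contra! hf
    exact hg0 (MvPolynomial.funext fun f => by rw [hf, map_zero])
  obtain ⟨J, hc, hJ, hJK⟩ := hK.exists_hasPos_comp hL (ofCoord f)
  have hd : IsDominant src tgt J := hg _ (by rwa [coord_ofCoord]) J hJ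
  have hle := hd.sum_le
  simp only [hc] at hle
  refine hle.trans (Finset.sum_le_sum fun x _ => ?_)
  rw [card_shearPairs_of_card_eq (hc x)]
  exact Finset.sum_le_sum fun j _ =>
    sub_le_sub_right (Nat.cast_le.mpr (Fin.le_def.mp (hJK x j))) _

end QRep

end Necessity

/-- numerical criterion for `Q`-intersecting Schubert families.
`K` is `Q`-intersecting for `n` iff for every family `L` that is `Q`-intersecting for the
dimension vector `k = (|K_x|)`, one has
`Σ_x Σ_{j=1}^{l_x} (K_x(L_x(j)) − j) ≥ Σ_{a:x→y} l_x (n_y − l_y)`. -/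
theorem qIntersecting_numerical_criterion
    {V A : Type} [Fintype V] [Fintype A] (src tgt : A → V)
    (hacyc : NoCycles src tgt) (n : V → ℕ) (K : ∀ x : V, Finset (Fin (n x))) :
    IsQIntersecting src tgt n K ↔
      ∀ L : ∀ x : V, Finset (Fin (K x).card),
        IsQIntersecting src tgt (fun x => (K x).card) L →
        (∑ a : A, ((L (src a)).card : ℤ) * ((n (tgt a) : ℤ) - ((L (tgt a)).card : ℤ))) ≤
          ∑ x : V, ∑ j : Fin (L x).card,
            (((((K x).orderIsoOfFin rfl ((L x).orderIsoOfFin rfl j : Fin (K x).card) :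
                Fin (n x)) : ℕ) : ℤ) - ((j : ℕ) : ℤ)) := by
  constructor
  · intro hK L hL
    exact hK.sum_le hL
  · intro h
    exact QRep.isQIntersecting_of_forall_le h
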